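/- arXiv:1805.05109 — 4 statements merged into one kernel-verified Lean document; each statement's English description precedes it below -/
import Mathlib

section
/- The alternating double sum U(3,1) := Σ_{m>n>0} (−1)^{m+n}/(m³ n) equals (1/2)·ζ(4) − 2·(Li₄(1/2) + (1/24)·(log 2)²·((log 2)² − π²)). -/
open Set Filter Topology

/-- The power series `∑ c n x^(n+1) / (n+1)^k`. -/
noncomputable def polylogSeries (c : ℕ → ℝ) (k : ℕ) (x : ℝ) : ℝ :=
  ∑' n : ℕ, c n * x ^ (n + 1) / ((n : ℝ) + 1) ^ k

/-- The polylogarithm `Li_k` on `[-1, 1]`. -/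
noncomputable def polylog (k : ℕ) (x : ℝ) : ℝ := polylogSeries (fun _ => 1) k x

lemma summable_one_div_succ_sq : Summable fun n : ℕ => 1 / ((n : ℝ) + 1) ^ 2 := by
  have h := (summable_nat_add_iff 1).2 (Real.summable_one_div_nat_pow.2 (one_lt_two))
  simpa using h

lemma abs_div_succ_pow_le (c : ℕ → ℝ) (x : ℝ) (k n : ℕ)
    (hc : |c n| ≤ (n : ℝ) + 1) : |c n * x ^ n / ((n : ℝ) + 1) ^ k| ≤ ((n : ℝ) + 1) * |x| ^ n := by
  rw [abs_div, abs_mul, abs_pow, abs_of_pos (by positivity : (0 : ℝ) < ((n : ℝ) + 1) ^ k)]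
  refine (div_le_self (by positivity) (one_le_pow₀ (by linarith [n.cast_nonneg (α := ℝ)]))).trans ?_
  gcongr

lemma summable_succ_mul_geometric {r : ℝ} (hr : |r| < 1) :
    Summable fun n : ℕ => ((n : ℝ) + 1) * r ^ n := by
  have h1 := summable_pow_mul_geometric_of_norm_lt_one (R := ℝ) 1 (r := r) hr
  have h2 := summable_geometric_of_norm_lt_one (x := r) hr
  simpa [add_mul] using h1.add h2

lemma summable_polylogSeries_of_abs_lt_one {c : ℕ → ℝ} (hc : ∀ n, |c n| ≤ (n : ℝ) + 1) (k : ℕ)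
    {x : ℝ} (hx : |x| < 1) : Summable fun n : ℕ => c n * x ^ n / ((n : ℝ) + 1) ^ k :=
  .of_norm_bounded (summable_succ_mul_geometric (r := |x|) (by simpa using hx))
    fun n => abs_div_succ_pow_le c x k n (hc n)

lemma polylogSeries_eq_mul_tsum (c : ℕ → ℝ) (k : ℕ) (x : ℝ) :
    polylogSeries c k x = x * ∑' n : ℕ, c n * x ^ n / ((n : ℝ) + 1) ^ k := by
  rw [polylogSeries, ← tsum_mul_left]
  congr 1 with n
  ring

lemma hasDerivAt_polylogSeries {c : ℕ → ℝ} (hc : ∀ n, |c n| ≤ (n : ℝ) + 1) (k : ℕ)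
    {x : ℝ} (hx : |x| < 1) (hx0 : x ≠ 0) :
    HasDerivAt (polylogSeries c (k + 1)) (polylogSeries c k x / x) x := by
  rw [polylogSeries_eq_mul_tsum, mul_div_cancel_left₀ _ hx0]
  obtain ⟨r, hxr, hr⟩ := exists_between hx
  have hr0 : 0 < r := (abs_nonneg x).trans_lt hxr
  refine hasDerivAt_tsum_of_isPreconnected (𝕜 := ℝ)
    (g := fun n y => c n * y ^ (n + 1) / ((n : ℝ) + 1) ^ (k + 1))
    (g' := fun n y => c n * y ^ n / ((n : ℝ) + 1) ^ k) (u := fun n : ℕ => ((n : ℝ) + 1) * r ^ n)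
    (t := Ioo (-r) r) (y₀ := 0)
    (summable_succ_mul_geometric (by rwa [abs_of_pos hr0])) isOpen_Ioo isPreconnected_Ioo
    (fun n y _ => ?_) (fun n y hy => ?_) (by simpa using hr0) ?_ (by rwa [mem_Ioo, ← abs_lt])
  · have h := (((hasDerivAt_id y).pow (n + 1)).const_mul (c n)).div_const (((n : ℝ) + 1) ^ (k + 1))
    refine h.congr_deriv ?_
    have : (n : ℝ) + 1 ≠ 0 := by positivity
    simp only [id, Nat.add_sub_cancel]
    push_cast
    field_simp
    ring
  · refine (abs_div_succ_pow_le c y k n (hc n)).trans ?_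
    have : |y| ≤ r := (abs_lt.2 hy).le
    gcongr
  · simp

lemma continuousOn_polylogSeries {c : ℕ → ℝ} {k : ℕ}
    (hc : ∀ n : ℕ, |c n / ((n : ℝ) + 1) ^ k| ≤ 1 / ((n : ℝ) + 1) ^ 2) :
    ContinuousOn (polylogSeries c k) (Icc (-1) 1) := by
  refine continuousOn_tsum (u := fun n : ℕ => 1 / ((n : ℝ) + 1) ^ 2) (fun n => by fun_prop)
    summable_one_div_succ_sq fun n x hx => ?_
  rw [mul_div_right_comm, norm_mul]
  refine (mul_le_of_le_one_right (norm_nonneg _) ?_).trans (hc n)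
  rw [norm_pow]
  exact pow_le_one₀ (norm_nonneg _) (abs_le.2 hx)

lemma polylogSeries_zero_right (c : ℕ → ℝ) (k : ℕ) : polylogSeries c k 0 = 0 := by
  simp [polylogSeries]

lemma polylog_zero_right (k : ℕ) : polylog k 0 = 0 := polylogSeries_zero_right _ k

lemma hasDerivAt_polylog (k : ℕ) {x : ℝ} (hx : |x| < 1) (hx0 : x ≠ 0) :
    HasDerivAt (polylog (k + 1)) (polylog k x / x) x :=
  hasDerivAt_polylogSeries (fun n => by simp) k hx hx0

lemma continuousOn_polylog (k : ℕ) : ContinuousOn (polylog (k + 2)) (Icc (-1) 1) := by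
  refine continuousOn_polylogSeries fun n => ?_
  rw [abs_of_pos (by positivity)]
  have : (1 : ℝ) ≤ (n : ℝ) + 1 := by simp
  gcongr
  omega

lemma polylog_one_left {x : ℝ} (hx : |x| < 1) : polylog 1 x = -Real.log (1 - x) := by
  simpa [polylog, polylogSeries] using (Real.hasSum_pow_div_log_of_abs_lt_one hx).tsum_eq

lemma eq_of_hasDerivAt_zero_Ioo {f : ℝ → ℝ} {x : ℝ} (hx : 0 ≤ x) (hf : ContinuousOn f (Icc 0 x))
    (hf' : ∀ y ∈ Ioo 0 x, HasDerivAt f 0 y) : f x = f 0 := by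
  rcases hx.eq_or_lt with rfl | h0
  · rfl
  obtain ⟨y, -, hy⟩ := exists_hasDerivAt_eq_slope f (fun _ => 0) h0 hf hf'
  have := (div_eq_zero_iff.1 hy.symm).resolve_right (by linarith)
  linarith

lemma eq_of_hasDerivAt_zero {f : ℝ → ℝ} (hf : ContinuousOn f (Icc 0 1))
    (hf' : ∀ x ∈ Ioo (0 : ℝ) 1, HasDerivAt f 0 x) {x : ℝ} (hx : x ∈ Icc (0 : ℝ) 1) :
    f x = f 0 :=
  eq_of_hasDerivAt_zero_Ioo hx.1 (hf.mono (Icc_subset_Icc_right hx.2))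
    fun y hy => hf' y (Ioo_subset_Ioo_right hx.2 hy)

lemma continuousOn_polylogSeries_of_lt_one {c : ℕ → ℝ} (hc : ∀ n, |c n| ≤ (n : ℝ) + 1) (k : ℕ)
    {r : ℝ} (hr0 : 0 ≤ r) (hr : r < 1) : ContinuousOn (polylogSeries c k) (Icc 0 r) := by
  simp only [funext (polylogSeries_eq_mul_tsum c k)]
  refine continuousOn_id.mul (continuousOn_tsum (u := fun n : ℕ => ((n : ℝ) + 1) * r ^ n)
    (fun n => by fun_prop) (summable_succ_mul_geometric (by rwa [abs_of_nonneg hr0]))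
    fun n x hx => (abs_div_succ_pow_le c x k n (hc n)).trans ?_)
  have : |x| ≤ r := by rw [abs_of_nonneg hx.1]; exact hx.2
  gcongr

lemma continuousOn_log_one_add : ContinuousOn (fun x : ℝ => Real.log (1 + x)) (Icc 0 1) :=
  ContinuousOn.log (by fun_prop) fun x hx => by linarith [hx.1]

lemma continuousOn_log_mul_log_one_add :
    ContinuousOn (fun x : ℝ => Real.log x * Real.log (1 + x)) (Icc 0 1) := by
  intro x hx
  rcases hx.1.eq_or_lt with rfl | h0
  · rw [ContinuousWithinAt]
    have h : Tendsto (fun x : ℝ => x * Real.log x) (𝓝[Icc 0 1] 0) (𝓝 0) := by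
      simpa using (Real.continuous_mul_log.tendsto 0).mono_left nhdsWithin_le_nhds
    have := h.norm
    rw [norm_zero] at this
    rw [add_zero, Real.log_one, mul_zero]
    refine squeeze_zero_norm' ?_ this
    filter_upwards [self_mem_nhdsWithin] with y hy
    rw [norm_mul, norm_mul, mul_comm]
    gcongr
    rw [Real.norm_of_nonneg (Real.log_nonneg (by linarith [hy.1])), Real.norm_of_nonneg hy.1]
    linarith [Real.log_le_sub_one_of_pos (by linarith [hy.1] : 0 < 1 + y)]
  · exact ((Real.continuousAt_log h0.ne').continuousWithinAt).mul (continuousOn_log_one_add x hx)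

lemma hasDerivAt_log_one_add {x : ℝ} (hx : 0 < x) :
    HasDerivAt (fun x : ℝ => Real.log (1 + x)) (1 / (1 + x)) x :=
  ((hasDerivAt_id x).const_add 1).log (by simp; linarith)

lemma continuousOn_polylog_neg (k : ℕ) :
    ContinuousOn (fun x : ℝ => polylog (k + 2) (-x)) (Icc 0 1) :=
  (continuousOn_polylog k).comp (by fun_prop) fun x hx => ⟨by linarith [hx.2], by linarith [hx.1]⟩

lemma continuousOn_polylog_inv (k : ℕ) :
    ContinuousOn (fun x : ℝ => polylog (k + 2) (1 / (1 + x))) (Icc 0 1) := by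
  refine (continuousOn_polylog k).comp ?_ fun x hx => ?_
  · exact continuousOn_const.div (by fun_prop) fun x hx => by linarith [hx.1]
  · have : 0 < 1 + x := by linarith [hx.1]
    exact ⟨by linarith [one_div_pos.2 this], (div_le_one this).2 (by linarith [hx.1])⟩

lemma continuousOn_polylog_div (k : ℕ) :
    ContinuousOn (fun x : ℝ => polylog (k + 2) (x / (1 + x))) (Icc 0 1) := by
  refine (continuousOn_polylog k).comp ?_ fun x hx => ?_
  · exact continuousOn_id.div (by fun_prop) fun x hx => by linarith [hx.1]
  · have : 0 < 1 + x := by linarith [hx.1]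
    exact ⟨by linarith [div_nonneg hx.1 this.le], (div_le_one this).2 (by linarith [hx.1])⟩

lemma hasDerivAt_polylog_neg (k : ℕ) {x : ℝ} (hx : x ∈ Ioo (0 : ℝ) 1) :
    HasDerivAt (fun x : ℝ => polylog (k + 1) (-x)) (polylog k (-x) / x) x := by
  have h := (hasDerivAt_polylog k (x := -x) (by rw [abs_neg, abs_of_pos hx.1]; exact hx.2)
    (by linarith [hx.1])).comp x (hasDerivAt_neg x)
  refine h.congr_deriv ?_
  rw [div_neg]; ring

lemma hasDerivAt_polylog_inv (k : ℕ) {x : ℝ} (hx : x ∈ Ioo (0 : ℝ) 1) :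
    HasDerivAt (fun x : ℝ => polylog (k + 1) (1 / (1 + x)))
      (-polylog k (1 / (1 + x)) / (1 + x)) x := by
  have h0 : 0 < 1 + x := by linarith [hx.1]
  have h := (hasDerivAt_polylog k (x := 1 / (1 + x))
    (by rw [abs_of_pos (by positivity)]; exact (div_lt_one h0).2 (by linarith [hx.1]))
    (by positivity)).comp x ((hasDerivAt_const x (1 : ℝ)).div ((hasDerivAt_id x).const_add 1) h0.ne')
  refine h.congr_deriv ?_
  simp only [id]
  field_simp
  ring

lemma hasDerivAt_polylog_div (k : ℕ) {x : ℝ} (hx : x ∈ Ioo (0 : ℝ) 1) :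
    HasDerivAt (fun x : ℝ => polylog (k + 1) (x / (1 + x)))
      (polylog k (x / (1 + x)) * (1 / x - 1 / (1 + x))) x := by
  have h0 : 0 < 1 + x := by linarith [hx.1]
  have hx0 := hx.1
  have h := (hasDerivAt_polylog k (x := x / (1 + x))
    (by rw [abs_of_pos (by positivity)]; exact (div_lt_one h0).2 (by linarith))
    (by positivity)).comp x ((hasDerivAt_id x).div ((hasDerivAt_id x).const_add 1) h0.ne')
  refine h.congr_deriv ?_
  simp only [id]
  field_simp

lemma polylog_one_neg {x : ℝ} (hx : x ∈ Ioo (0 : ℝ) 1) :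
    polylog 1 (-x) = -Real.log (1 + x) := by
  rw [polylog_one_left (by rw [abs_neg, abs_of_pos hx.1]; exact hx.2), sub_neg_eq_add]

lemma polylog_one_inv {x : ℝ} (hx : x ∈ Ioo (0 : ℝ) 1) :
    polylog 1 (1 / (1 + x)) = Real.log (1 + x) - Real.log x := by
  have h0 : 0 < 1 + x := by linarith [hx.1]
  rw [polylog_one_left (by rw [abs_of_pos (by positivity), div_lt_one h0]; linarith [hx.1]),
    show 1 - 1 / (1 + x) = x / (1 + x) by field_simp; ring,
    Real.log_div hx.1.ne' h0.ne']
  ring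

lemma polylog_one_div {x : ℝ} (hx : x ∈ Ioo (0 : ℝ) 1) :
    polylog 1 (x / (1 + x)) = Real.log (1 + x) := by
  have h0 : 0 < 1 + x := by linarith [hx.1]
  have hx0 := hx.1
  rw [polylog_one_left (by rw [abs_of_pos (by positivity), div_lt_one h0]; linarith [hx.1]),
    show 1 - x / (1 + x) = (1 + x)⁻¹ by field_simp; ring, Real.log_inv]
  ring

lemma polylog_two_div {x : ℝ} (hx : x ∈ Icc (0 : ℝ) 1) :
    polylog 2 (x / (1 + x)) = -polylog 2 (-x) - Real.log (1 + x) ^ 2 / 2 := by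
  have key := eq_of_hasDerivAt_zero
    (f := fun x => polylog 2 (x / (1 + x)) + polylog 2 (-x) + Real.log (1 + x) ^ 2 / 2)
    (((continuousOn_polylog_div 0).add (continuousOn_polylog_neg 0)).add
      ((continuousOn_log_one_add.pow 2).div_const 2)) (fun y hy => ?_) hx
  · simp only [zero_div, neg_zero, polylog_zero_right, add_zero, Real.log_one] at key
    linarith
  · have h0 : 0 < 1 + y := by linarith [hy.1]
    have hy0 := hy.1
    refine (((hasDerivAt_polylog_div 1 hy).add (hasDerivAt_polylog_neg 1 hy)).add
      (((hasDerivAt_log_one_add hy.1).pow 2).div_const 2)).congr_deriv ?_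
    rw [polylog_one_div hy, polylog_one_neg hy]
    field_simp
    ring

lemma polylog_two_inv {x : ℝ} (hx : x ∈ Icc (0 : ℝ) 1) :
    polylog 2 (1 / (1 + x)) = polylog 2 1 - polylog 2 (x / (1 + x))
      + Real.log x * Real.log (1 + x) - Real.log (1 + x) ^ 2 := by
  have key := eq_of_hasDerivAt_zero
    (f := fun x => polylog 2 (1 / (1 + x)) + polylog 2 (x / (1 + x))
      - Real.log x * Real.log (1 + x) + Real.log (1 + x) ^ 2)
    ((((continuousOn_polylog_inv 0).add (continuousOn_polylog_div 0)).sub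
      continuousOn_log_mul_log_one_add).add (continuousOn_log_one_add.pow 2)) (fun y hy => ?_) hx
  · simp only [div_one, polylog_zero_right, add_zero, Real.log_one] at key
    linarith
  · have h0 : 0 < 1 + y := by linarith [hy.1]
    have hy0 := hy.1
    have hP := hasDerivAt_log_one_add hy.1
    refine ((((hasDerivAt_polylog_inv 1 hy).add (hasDerivAt_polylog_div 1 hy)).sub
      ((Real.hasDerivAt_log hy0.ne').mul hP)).add (hP.pow 2)).congr_deriv ?_
    rw [polylog_one_div hy, polylog_one_inv hy]
    field_simp
    ring

lemma polylog_three_div {x : ℝ} (hx : x ∈ Icc (0 : ℝ) 1) :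
    polylog 3 (x / (1 + x)) = polylog 3 1 - polylog 3 (-x) - polylog 3 (1 / (1 + x))
      + Real.log (1 + x) ^ 3 / 3 - polylog 2 1 * Real.log (1 + x)
      - Real.log x * Real.log (1 + x) * Real.log (1 + x) / 2 := by
  have key := eq_of_hasDerivAt_zero
    (f := fun x => polylog 3 (x / (1 + x)) + polylog 3 (-x) + polylog 3 (1 / (1 + x))
      - Real.log (1 + x) ^ 3 / 3 + polylog 2 1 * Real.log (1 + x)
      + Real.log x * Real.log (1 + x) * Real.log (1 + x) / 2)
    ((((((continuousOn_polylog_div 1).add (continuousOn_polylog_neg 1)).add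
      (continuousOn_polylog_inv 1)).sub ((continuousOn_log_one_add.pow 3).div_const 3)).add
      (continuousOn_const.mul continuousOn_log_one_add)).add
      ((continuousOn_log_mul_log_one_add.mul continuousOn_log_one_add).div_const 2))
    (fun y hy => ?_) hx
  · simp only [div_one, neg_zero, polylog_zero_right, add_zero, Real.log_one] at key
    linarith
  · have h0 : 0 < 1 + y := by linarith [hy.1]
    have hy0 := hy.1
    have hP := hasDerivAt_log_one_add hy.1
    refine ((((((hasDerivAt_polylog_div 2 hy).add (hasDerivAt_polylog_neg 2 hy)).add
      (hasDerivAt_polylog_inv 2 hy)).sub ((hP.pow 3).div_const 3)).add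
      (hP.const_mul (polylog 2 1))).add
      ((((Real.hasDerivAt_log hy0.ne').mul hP).mul hP).div_const 2)).congr_deriv ?_
    have hy' := Ioo_subset_Icc_self hy
    simp only [polylog_two_inv hy', polylog_two_div hy', Pi.mul_apply]
    field_simp
    ring

/-- Partial sums of the series `-log (1 - x) = ∑ x^(n+1) / (n+1)`. -/
noncomputable def logPartial (x : ℝ) (m : ℕ) : ℝ :=
  ∑ n ∈ Finset.range m, x ^ (n + 1) / ((n : ℝ) + 1)

lemma logPartial_succ (x : ℝ) (m : ℕ) :
    logPartial x (m + 1) = logPartial x m + x ^ (m + 1) / ((m : ℝ) + 1) :=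
  Finset.sum_range_succ _ _

lemma abs_logPartial_le {x : ℝ} (hx : |x| ≤ 1) (m : ℕ) : |logPartial x m| ≤ (m : ℝ) + 1 := by
  have h : |logPartial x m| ≤ m • (1 : ℝ) := by
    rw [← Finset.card_range m, ← Finset.sum_const, Finset.card_range]
    refine (Finset.abs_sum_le_sum_abs _ _).trans (Finset.sum_le_sum fun n _ => ?_)
    rw [abs_div, abs_pow, abs_of_pos (by positivity : (0 : ℝ) < (n : ℝ) + 1)]
    exact div_le_one_of_le₀ ((pow_le_one₀ (abs_nonneg _) hx).trans (by simp)) (by positivity)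
  simp only [nsmul_eq_mul, mul_one] at h
  linarith

/-- Signed harmonic numbers `(-1)^(n+1) H_n`. -/
noncomputable def signedHarmonic (n : ℕ) : ℝ := (-1) ^ (n + 1) * logPartial 1 n

lemma abs_signedHarmonic_le (n : ℕ) : |signedHarmonic n| ≤ (n : ℝ) + 1 := by
  rw [signedHarmonic, abs_mul, abs_pow, abs_neg, abs_one, one_pow, one_mul]
  exact abs_logPartial_le (by simp) n

lemma abs_div_succ_pow_le_one_div_sq {c : ℕ → ℝ} (hc : ∀ n, |c n| ≤ (n : ℝ) + 1) (k n : ℕ) :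
    |c n / ((n : ℝ) + 1) ^ (k + 3)| ≤ 1 / ((n : ℝ) + 1) ^ 2 := by
  have h0 : (0 : ℝ) < (n : ℝ) + 1 := by positivity
  have h1 : (1 : ℝ) ≤ (n : ℝ) + 1 := by simp
  rw [abs_div, abs_of_pos (pow_pos h0 (k + 3)), div_le_div_iff₀ (by positivity) (by positivity),
    one_mul]
  calc |c n| * ((n : ℝ) + 1) ^ 2 ≤ ((n : ℝ) + 1) * ((n : ℝ) + 1) ^ 2 := by gcongr; exact hc n
    _ = ((n : ℝ) + 1) ^ 3 := by ring
    _ ≤ ((n : ℝ) + 1) ^ (k + 3) := by gcongr; omega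

lemma polylogSeries_signedHarmonic_zero {x : ℝ} (hx : |x| < 1) :
    polylogSeries signedHarmonic 0 x = x * Real.log (1 + x) / (1 + x) := by
  have h0 : 1 + x ≠ 0 := by linarith [(abs_lt.1 hx).1]
  have hs : Summable fun n : ℕ => signedHarmonic n * x ^ n := by
    simpa using summable_polylogSeries_of_abs_lt_one abs_signedHarmonic_le 0 hx
  have hlog := Real.hasSum_pow_div_log_of_abs_lt_one (x := -x) (by rwa [abs_neg])
  rw [polylogSeries_eq_mul_tsum]
  simp only [pow_zero, div_one]
  have h1 := hs.tsum_eq_zero_add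
  have h2 : ∑' n : ℕ, signedHarmonic (n + 1) * x ^ (n + 1)
      = -x * (∑' n : ℕ, signedHarmonic n * x ^ n)
        - ∑' n : ℕ, (-x) ^ (n + 1) / ((n : ℝ) + 1) := by
    rw [← tsum_mul_left, ← (hs.mul_left _).tsum_sub hlog.summable]
    congr 1 with n
    rw [signedHarmonic, signedHarmonic, logPartial_succ, one_pow, neg_pow x]
    ring
  rw [h2, hlog.tsum_eq] at h1
  simp only [signedHarmonic, logPartial, Finset.range_zero, Finset.sum_empty, mul_zero,
    zero_mul, zero_add, sub_neg_eq_add] at h1 ⊢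
  rw [mul_div_assoc]
  congr 1
  rw [eq_div_iff h0]
  linarith

lemma polylogSeries_signedHarmonic_one {x : ℝ} (hx : x ∈ Ico (0 : ℝ) 1) :
    polylogSeries signedHarmonic 1 x = Real.log (1 + x) ^ 2 / 2 := by
  have key := eq_of_hasDerivAt_zero_Ioo
    (f := fun x => polylogSeries signedHarmonic 1 x - Real.log (1 + x) ^ 2 / 2) hx.1
    ((continuousOn_polylogSeries_of_lt_one abs_signedHarmonic_le 1 hx.1 hx.2).sub
      (((continuousOn_log_one_add.mono (Icc_subset_Icc_right hx.2.le)).pow 2).div_const 2))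
    fun y hy => ?_
  · simp only [polylogSeries_zero_right, add_zero, Real.log_one] at key
    linarith
  · have hy1 : |y| < 1 := by rw [abs_of_pos hy.1]; exact hy.2.trans hx.2
    have hy0 := hy.1
    refine ((hasDerivAt_polylogSeries abs_signedHarmonic_le 0 hy1 hy0.ne').sub
      (((hasDerivAt_log_one_add hy0).pow 2).div_const 2)).congr_deriv ?_
    rw [polylogSeries_signedHarmonic_zero hy1]
    field_simp
    ring

lemma polylogSeries_signedHarmonic_two {x : ℝ} (hx : x ∈ Ico (0 : ℝ) 1) :
    polylogSeries signedHarmonic 2 x = polylog 3 (-x) + polylog 3 (x / (1 + x))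
      - Real.log (1 + x) * polylog 2 (-x) - Real.log (1 + x) ^ 3 / 6 := by
  have hsub : Icc 0 x ⊆ Icc 0 1 := Icc_subset_Icc_right hx.2.le
  have key := eq_of_hasDerivAt_zero_Ioo
    (f := fun x => polylogSeries signedHarmonic 2 x - (polylog 3 (-x) + polylog 3 (x / (1 + x))
      - Real.log (1 + x) * polylog 2 (-x) - Real.log (1 + x) ^ 3 / 6)) hx.1
    ((continuousOn_polylogSeries_of_lt_one abs_signedHarmonic_le 2 hx.1 hx.2).sub
      (((((continuousOn_polylog_neg 1).add (continuousOn_polylog_div 1)).sub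
        (continuousOn_log_one_add.mul (continuousOn_polylog_neg 0))).sub
        ((continuousOn_log_one_add.pow 3).div_const 6)).mono hsub))
    fun y hy => ?_
  · simp only [polylogSeries_zero_right, polylog_zero_right, neg_zero, zero_div, add_zero,
      Real.log_one] at key
    linarith
  · have hy' : y ∈ Ioo (0 : ℝ) 1 := ⟨hy.1, hy.2.trans hx.2⟩
    have hy1 : |y| < 1 := by rw [abs_of_pos hy.1]; exact hy'.2
    have hy0 := hy.1
    have hP := hasDerivAt_log_one_add hy0
    refine ((hasDerivAt_polylogSeries abs_signedHarmonic_le 1 hy1 hy0.ne').sub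
      ((((hasDerivAt_polylog_neg 2 hy').add (hasDerivAt_polylog_div 2 hy')).sub
        (hP.mul (hasDerivAt_polylog_neg 1 hy'))).sub ((hP.pow 3).div_const 6))).congr_deriv ?_
    rw [polylogSeries_signedHarmonic_one (Ioo_subset_Ico_self hy'), polylog_one_neg hy',
      polylog_two_div (Ioo_subset_Icc_self hy')]
    field_simp
    ring

lemma polylogSeries_signedHarmonic_three :
    polylogSeries signedHarmonic 3 1 = polylog 4 (-1) + 2 * polylog 4 (1 / 2) - polylog 4 1
      + polylog 3 1 * Real.log 2 - polylog 2 1 * Real.log 2 ^ 2 / 2 + Real.log 2 ^ 4 / 12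
      - Real.log 2 * polylog 3 (-1) := by
  let u : ℝ → ℝ := fun x => polylog 4 (-x) + polylog 4 (x / (1 + x)) + polylog 4 (1 / (1 + x))
    - Real.log (1 + x) * polylog 3 (-x)
  let v : ℝ → ℝ := fun x => polylog 3 1 * Real.log (1 + x)
    - polylog 2 1 * Real.log (1 + x) ^ 2 / 2 + Real.log (1 + x) ^ 4 / 12
    - Real.log x * Real.log (1 + x) * Real.log (1 + x) ^ 2 / 6
  have hu : ContinuousOn u (Icc 0 1) :=
    (((continuousOn_polylog_neg 2).add (continuousOn_polylog_div 2)).add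
      (continuousOn_polylog_inv 2)).sub (continuousOn_log_one_add.mul (continuousOn_polylog_neg 1))
  have hv : ContinuousOn v (Icc 0 1) :=
    (((continuousOn_const.mul continuousOn_log_one_add).sub
      ((continuousOn_const.mul (continuousOn_log_one_add.pow 2)).div_const 2)).add
      ((continuousOn_log_one_add.pow 4).div_const 12)).sub
      ((continuousOn_log_mul_log_one_add.mul (continuousOn_log_one_add.pow 2)).div_const 6)
  have hS : ContinuousOn (polylogSeries signedHarmonic 3) (Icc 0 1) :=
    (continuousOn_polylogSeries (abs_div_succ_pow_le_one_div_sq abs_signedHarmonic_le 0)).mono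
      (Icc_subset_Icc_left (by norm_num))
  have key := eq_of_hasDerivAt_zero (f := fun x => polylogSeries signedHarmonic 3 x - (u x + v x))
    (hS.sub (hu.add hv)) (fun y hy => ?_) (right_mem_Icc.2 zero_le_one)
  · simp only [u, v, polylogSeries_zero_right, polylog_zero_right, neg_zero, add_zero,
      Real.log_one, div_one, one_add_one_eq_two] at key
    linarith
  · have hy1 : |y| < 1 := by rw [abs_of_pos hy.1]; exact hy.2
    have hy0 := hy.1
    have hP := hasDerivAt_log_one_add hy0
    have hu' : HasDerivAt u _ y :=
      (((hasDerivAt_polylog_neg 3 hy).add (hasDerivAt_polylog_div 3 hy)).add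
        (hasDerivAt_polylog_inv 3 hy)).sub (hP.mul (hasDerivAt_polylog_neg 2 hy))
    have hv' : HasDerivAt v _ y :=
      (((hP.const_mul (polylog 3 1)).sub (((hP.pow 2).const_mul (polylog 2 1)).div_const 2)).add
        ((hP.pow 4).div_const 12)).sub
        ((((Real.hasDerivAt_log hy0.ne').mul hP).mul (hP.pow 2)).div_const 6)
    refine ((hasDerivAt_polylogSeries abs_signedHarmonic_le 2 hy1 hy0.ne').sub
      (hu'.add hv')).congr_deriv ?_
    simp only [polylogSeries_signedHarmonic_two (Ioo_subset_Ico_self hy),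
      polylog_three_div (Ioo_subset_Icc_self hy), Pi.mul_apply, Pi.pow_apply]
    field_simp
    ring

lemma summable_polylog (k : ℕ) {x : ℝ} (hx : x ∈ Icc (-1 : ℝ) 1) :
    Summable fun n : ℕ => x ^ (n + 1) / ((n : ℝ) + 1) ^ (k + 2) := by
  refine .of_norm_bounded summable_one_div_succ_sq fun n => ?_
  rw [norm_div, norm_pow, norm_pow, Real.norm_of_nonneg (by positivity : 0 ≤ (n : ℝ) + 1)]
  have h1 : (1 : ℝ) ≤ (n : ℝ) + 1 := by simp
  have h2 : ‖x‖ ^ (n + 1) ≤ 1 := pow_le_one₀ (norm_nonneg _) (abs_le.2 hx)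
  gcongr
  omega

lemma polylog_eq_tsum (k : ℕ) (x : ℝ) :
    polylog k x = ∑' n : ℕ, x ^ (n + 1) / ((n : ℝ) + 1) ^ k := by
  simp [polylog, polylogSeries]

lemma tsum_even_add_odd_of_summable {f : ℕ → ℝ} (hf : Summable f) :
    ∑' j : ℕ, f (2 * j) + ∑' j : ℕ, f (2 * j + 1) = ∑' n, f n :=
  tsum_even_add_odd (hf.comp_injective (mul_right_injective₀ two_ne_zero))
    (hf.comp_injective ((add_left_injective 1).comp (mul_right_injective₀ two_ne_zero)))

lemma two_pow_mul_polylog_one_add_polylog_neg_one (k : ℕ) :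
    2 ^ (k + 2) * (polylog (k + 2) 1 + polylog (k + 2) (-1)) = 2 * polylog (k + 2) 1 := by
  have h1 := summable_polylog k (x := 1) (by simp)
  have h2 := summable_polylog k (x := -1) (by simp)
  have h0 : ∀ j : ℕ, (1 : ℝ) ^ (2 * j + 1) / (((2 * j : ℕ) : ℝ) + 1) ^ (k + 2)
      + (-1) ^ (2 * j + 1) / (((2 * j : ℕ) : ℝ) + 1) ^ (k + 2) = 0 := fun j => by
    rw [(odd_two_mul_add_one j).neg_one_pow, one_pow]; ring
  have h3 : ∀ j : ℕ, (2 : ℝ) ^ (k + 2) *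
      ((1 : ℝ) ^ (2 * j + 1 + 1) / (((2 * j + 1 : ℕ) : ℝ) + 1) ^ (k + 2)
      + (-1) ^ (2 * j + 1 + 1) / (((2 * j + 1 : ℕ) : ℝ) + 1) ^ (k + 2))
      = 2 * ((1 : ℝ) ^ (j + 1) / ((j : ℝ) + 1) ^ (k + 2)) := fun j => by
    rw [show 2 * j + 1 + 1 = 2 * (j + 1) by ring, pow_mul (-1 : ℝ), neg_one_sq, one_pow, one_pow,
      show (((2 * j + 1 : ℕ) : ℝ) + 1) = 2 * (j + 1) by push_cast; ring, mul_pow]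
    field_simp
    norm_num
  rw [polylog_eq_tsum, polylog_eq_tsum, ← h1.tsum_add h2,
    ← tsum_even_add_odd_of_summable (h1.add h2)]
  simp only [h0, tsum_zero, zero_add]
  rw [← tsum_mul_left, ← tsum_mul_left]
  exact tsum_congr h3

lemma polylog_one_right {k : ℕ} (hk : k ≠ 0) {a : ℝ}
    (h : HasSum (fun n : ℕ => (1 : ℝ) / (n : ℝ) ^ k) a) : polylog k 1 = a := by
  rw [← h.tsum_eq, h.summable.tsum_eq_zero_add, polylog_eq_tsum]
  simp [hk]

lemma polylog_two_one : polylog 2 1 = Real.pi ^ 2 / 6 :=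
  polylog_one_right two_ne_zero hasSum_zeta_two

lemma polylog_four_one : polylog 4 1 = Real.pi ^ 4 / 90 :=
  polylog_one_right four_ne_zero hasSum_zeta_four

lemma polylogSeries_logPartial_one_neg_one :
    polylogSeries (logPartial 1) 3 (-1) = polylogSeries signedHarmonic 3 1 := by
  simp only [polylogSeries, signedHarmonic, one_pow, mul_one]
  exact tsum_congr fun n => by rw [mul_comm (logPartial 1 n)]

lemma hasDerivAt_logPartial_neg (m : ℕ) {x : ℝ} (hx : 0 ≤ x) :
    HasDerivAt (fun x : ℝ => logPartial (-x) m) (-((1 - (-x) ^ m) / (1 + x))) x := by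
  have h0 : 1 + x ≠ 0 := by linarith
  have hterm : ∀ n ∈ Finset.range m, HasDerivAt
      (fun x : ℝ => (-x) ^ (n + 1) / ((n : ℝ) + 1)) (-(-x) ^ n) x := fun n _ => by
    refine (((hasDerivAt_neg x).pow (n + 1)).div_const ((n : ℝ) + 1)).congr_deriv ?_
    have : (n : ℝ) + 1 ≠ 0 := by positivity
    simp only [Nat.add_sub_cancel]
    push_cast
    field_simp
  refine (HasDerivAt.fun_sum hterm).congr_deriv ?_
  rw [Finset.sum_neg_distrib, geom_sum_eq (by linarith), ← neg_div_neg_eq ((-x) ^ m - 1)]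
  ring

lemma abs_one_sub_neg_pow_div_le (m : ℕ) {x : ℝ} (hx : x ∈ Icc (0 : ℝ) 1) :
    |(1 - (-x) ^ m) / (1 + x)| ≤ (m : ℝ) + 1 := by
  have h0 : 0 < 1 + x := by linarith [hx.1]
  rcases m with - | m
  · simp
  rw [abs_div, abs_of_pos h0]
  have h1 : |(-x) ^ (m + 1)| ≤ 1 := by
    rw [abs_pow, abs_neg, abs_of_nonneg hx.1]
    exact pow_le_one₀ hx.1 hx.2
  have h2 : |1 - (-x) ^ (m + 1)| ≤ 2 := by
    rw [abs_le] at h1 ⊢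
    constructor <;> linarith
  refine (div_le_self (abs_nonneg _) (by linarith [hx.1])).trans (h2.trans ?_)
  push_cast
  linarith [m.cast_nonneg (α := ℝ)]

lemma polylogSeries_logPartial_neg_one_one :
    polylogSeries (logPartial (-1)) 3 1 = -(polylog 3 1 * Real.log 2) - polylog 4 (-1)
      + Real.log 2 * polylog 3 (-1) + polylog 2 (-1) ^ 2 / 2 := by
  let w : ℝ → ℝ := fun x => ∑' m : ℕ, logPartial (-x) m / ((m : ℝ) + 1) ^ 3
  let u : ℝ → ℝ := fun x => -(polylog 3 1 * Real.log (1 + x)) - polylog 4 (-x)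
      + Real.log (1 + x) * polylog 3 (-x) + polylog 2 (-x) ^ 2 / 2
  have hw : ContinuousOn w (Icc 0 1) :=
    continuousOn_tsum (fun m => ContinuousOn.div_const (fun x hx =>
      (hasDerivAt_logPartial_neg m hx.1).continuousAt.continuousWithinAt) _)
      summable_one_div_succ_sq fun m x hx => abs_div_succ_pow_le_one_div_sq
        (abs_logPartial_le (by rw [abs_neg, abs_of_nonneg hx.1]; exact hx.2)) 0 m
  have hw' : ∀ x ∈ Ioo (0 : ℝ) 1,
      HasDerivAt w (-((polylog 3 1 + polylog 3 (-x) / x) / (1 + x))) x := fun x hx => by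
    have h := hasDerivAt_tsum_of_isPreconnected (𝕜 := ℝ)
      (g := fun m x => logPartial (-x) m / ((m : ℝ) + 1) ^ 3)
      (g' := fun m x => -((1 - (-x) ^ m) / (1 + x)) / ((m : ℝ) + 1) ^ 3)
      summable_one_div_succ_sq isOpen_Ioo isPreconnected_Ioo
      (fun m y hy => (hasDerivAt_logPartial_neg m (le_of_lt hy.1)).div_const _)
      (fun m y hy => abs_div_succ_pow_le_one_div_sq (c := fun m => -((1 - (-y) ^ m) / (1 + y)))
        (fun m => by
          rw [abs_neg]
          exact abs_one_sub_neg_pow_div_le m (Ioo_subset_Icc_self hy)) 0 m) hx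
      (.of_norm_bounded summable_one_div_succ_sq fun m => abs_div_succ_pow_le_one_div_sq
        (abs_logPartial_le (by rw [abs_neg, abs_of_nonneg hx.1.le]; exact hx.2.le)) 0 m) hx
    refine h.congr_deriv ?_
    have hx0 := hx.1
    have s1 := summable_polylog 1 (x := 1) (by simp)
    have s2 := summable_polylog 1 (x := -x) ⟨by linarith [hx.2], by linarith⟩
    rw [polylog_eq_tsum, polylog_eq_tsum, ← tsum_div_const, ← s1.tsum_add (s2.div_const x),
      ← tsum_div_const, ← tsum_neg]
    refine tsum_congr fun m => ?_
    field_simp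
    ring
  have hu : ContinuousOn u (Icc 0 1) :=
    (((continuousOn_const.mul continuousOn_log_one_add).neg.sub (continuousOn_polylog_neg 2)).add
      (continuousOn_log_one_add.mul (continuousOn_polylog_neg 1))).add
      (((continuousOn_polylog_neg 0).pow 2).div_const 2)
  have key := eq_of_hasDerivAt_zero (f := fun x => w x - u x) (hw.sub hu) (fun x hx => ?_)
    (right_mem_Icc.2 zero_le_one)
  · have h1 : w 1 = polylogSeries (logPartial (-1)) 3 1 := by simp [w, polylogSeries]
    have h0 : w 0 = 0 := by simp [w, logPartial]
    simp only [h1, h0, u, polylog_zero_right, neg_zero, add_zero, Real.log_one,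
      one_add_one_eq_two] at key
    linarith
  · have hx0 := hx.1
    have hP := hasDerivAt_log_one_add hx0
    have hu' : HasDerivAt u _ x :=
      (((hP.const_mul (polylog 3 1)).neg.sub (hasDerivAt_polylog_neg 3 hx)).add
        (hP.mul (hasDerivAt_polylog_neg 2 hx))).add
        (((hasDerivAt_polylog_neg 1 hx).pow 2).div_const 2)
    refine ((hw' x hx).sub hu').congr_deriv ?_
    rw [polylog_one_neg hx]
    field_simp
    ring

lemma summable_polylogSeries_three {c : ℕ → ℝ} (hc : ∀ n, |c n| ≤ (n : ℝ) + 1) {x : ℝ}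
    (hx : |x| ≤ 1) : Summable fun n : ℕ => c n * x ^ (n + 1) / ((n : ℝ) + 1) ^ 3 := by
  refine .of_norm_bounded summable_one_div_succ_sq fun n =>
    abs_div_succ_pow_le_one_div_sq (c := fun n => c n * x ^ (n + 1)) (fun n => ?_) 0 n
  rw [abs_mul, abs_pow]
  exact (mul_le_of_le_one_right (abs_nonneg _) (pow_le_one₀ (abs_nonneg _) hx)).trans (hc n)

lemma logPartial_one_add_logPartial_neg_one (j : ℕ) :
    logPartial 1 (2 * j + 1) + logPartial (-1) (2 * j + 1) = logPartial 1 j := by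
  induction j with
  | zero => simp [logPartial]
  | succ j ih =>
    rw [show 2 * (j + 1) + 1 = 2 * j + 1 + 1 + 1 by ring, logPartial_succ, logPartial_succ,
      logPartial_succ (-1), logPartial_succ (-1), logPartial_succ 1 j, ← ih,
      show 2 * j + 1 + 1 + 1 = 2 * (j + 1) + 1 by ring, show 2 * j + 1 + 1 = 2 * (j + 1) by ring,
      pow_succ (-1 : ℝ) (2 * (j + 1)), pow_mul (-1 : ℝ), neg_one_sq]
    push_cast
    simp only [one_pow]
    field_simp
    ring

lemma polylogSeries_logPartial_distribution :
    polylogSeries (logPartial 1) 3 1 + polylogSeries (logPartial 1) 3 (-1)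
      + polylogSeries (logPartial (-1)) 3 1 + polylogSeries (logPartial (-1)) 3 (-1)
      = polylogSeries (logPartial 1) 3 1 / 4 := by
  have b1 := abs_logPartial_le (x := 1) (by simp)
  have b2 := abs_logPartial_le (x := -1) (by simp)
  have s1 := summable_polylogSeries_three b1 (x := 1) (by simp)
  have s2 := summable_polylogSeries_three b1 (x := -1) (by simp)
  have s3 := summable_polylogSeries_three b2 (x := 1) (by simp)
  have s4 := summable_polylogSeries_three b2 (x := -1) (by simp)
  simp only [polylogSeries]
  rw [← s1.tsum_add s2, ← (s1.add s2).tsum_add s3, ← ((s1.add s2).add s3).tsum_add s4,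
    ← tsum_even_add_odd_of_summable (((s1.add s2).add s3).add s4), ← tsum_div_const,
    ← zero_add (∑' i : ℕ, _ / 4)]
  congr 1
  · refine (tsum_congr fun j => ?_).trans tsum_zero
    rw [(odd_two_mul_add_one j).neg_one_pow, one_pow]
    ring
  · refine tsum_congr fun j => ?_
    rw [← logPartial_one_add_logPartial_neg_one j, show 2 * j + 1 + 1 = 2 * (j + 1) by ring,
      pow_mul (-1 : ℝ), neg_one_sq]
    push_cast
    simp only [one_pow]
    field_simp
    ring

lemma sum_antidiagonal_one_div_sq_mul (p : ℕ) :
    ∑ q ∈ Finset.HasAntidiagonal.antidiagonal p, 1 / ((q.1 : ℝ) + 1) ^ 2 * (1 / ((q.2 : ℝ) + 1) ^ 2)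
      = 2 * (∑ i ∈ Finset.range (p + 1), 1 / ((i : ℝ) + 1) ^ 2) / (((p + 1 : ℕ) : ℝ) + 1) ^ 2
        + 4 * (logPartial 1 (p + 1) / (((p + 1 : ℕ) : ℝ) + 1) ^ 3) := by
  let f : ℕ → ℝ := fun i => 1 / ((i : ℝ) + 1) ^ 2 / (((p + 1 : ℕ) : ℝ) + 1) ^ 2
    + 2 * (1 / ((i : ℝ) + 1) / (((p + 1 : ℕ) : ℝ) + 1) ^ 3)
  have hf : ∑ q ∈ Finset.HasAntidiagonal.antidiagonal p, f q.1 = ∑ i ∈ Finset.range (p + 1), f i :=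
    Finset.Nat.sum_antidiagonal_eq_sum_range_succ_mk (fun q => f q.1) p
  have hf' : ∑ q ∈ Finset.HasAntidiagonal.antidiagonal p, f q.2
      = ∑ q ∈ Finset.HasAntidiagonal.antidiagonal p, f q.1 :=
    Finset.Nat.sum_antidiagonal_swap (n := p) (f := fun q => f q.1)
  have h : ∀ q ∈ Finset.HasAntidiagonal.antidiagonal p,
      1 / ((q.1 : ℝ) + 1) ^ 2 * (1 / ((q.2 : ℝ) + 1) ^ 2) = f q.1 + f q.2 := fun q hq => by
    rw [Finset.HasAntidiagonal.mem_antidiagonal] at hq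
    have : (p : ℝ) = q.1 + q.2 := by rw [← hq]; push_cast; ring
    simp only [f]
    push_cast
    rw [this]
    field_simp
    ring
  rw [Finset.sum_congr rfl h, Finset.sum_add_distrib, hf', hf]
  simp only [f, Finset.sum_add_distrib, ← Finset.mul_sum, ← Finset.sum_div, logPartial, one_pow]
  ring

lemma hasSum_two_mul_sum_range_one_div_sq :
    HasSum (fun n : ℕ => 2 * (∑ i ∈ Finset.range n, 1 / ((i : ℝ) + 1) ^ 2) / ((n : ℝ) + 1) ^ 2
      + 1 / ((n : ℝ) + 1) ^ 4) (polylog 2 1 ^ 2) := by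
  rw [hasSum_iff_tendsto_nat_of_nonneg (fun n => by positivity)]
  have h := summable_one_div_succ_sq.hasSum.tendsto_sum_nat.pow 2
  rw [polylog_eq_tsum]
  simp only [one_pow]
  refine h.congr fun N => ?_
  induction N with
  | zero => simp
  | succ N ih =>
    rw [Finset.sum_range_succ, Finset.sum_range_succ, ← ih]
    field_simp
    ring

lemma polylogSeries_logPartial_one_one : polylogSeries (logPartial 1) 3 1 = polylog 4 1 / 4 := by
  have hH : Summable fun n : ℕ => logPartial 1 n / ((n : ℝ) + 1) ^ 3 := by
    simpa using summable_polylogSeries_three (abs_logPartial_le (x := 1) (by simp)) (x := 1)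
      (by simp)
  have h4 : Summable fun n : ℕ => 1 / ((n : ℝ) + 1) ^ 4 := by
    simpa using summable_polylog 2 (x := 1) (by simp)
  have hA := hasSum_two_mul_sum_range_one_div_sq
  have hB : Summable fun n : ℕ =>
      2 * (∑ i ∈ Finset.range n, 1 / ((i : ℝ) + 1) ^ 2) / ((n : ℝ) + 1) ^ 2 := by
    simpa using hA.summable.sub h4
  have hsq : polylog 2 1 ^ 2 = ∑' n : ℕ,
      (2 * (∑ i ∈ Finset.range n, 1 / ((i : ℝ) + 1) ^ 2) / ((n : ℝ) + 1) ^ 2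
        + 4 * (logPartial 1 n / ((n : ℝ) + 1) ^ 3)) := by
    rw [(hB.add (hH.mul_left 4)).tsum_eq_zero_add, polylog_eq_tsum, sq]
    simp only [one_pow]
    rw [tsum_mul_tsum_eq_tsum_sum_antidiagonal_of_summable_norm summable_one_div_succ_sq.norm
      summable_one_div_succ_sq.norm, tsum_congr sum_antidiagonal_one_div_sq_mul]
    simp [logPartial]
  have hA' := hA.tsum_eq
  rw [hB.tsum_add h4] at hA'
  rw [hB.tsum_add (hH.mul_left 4), tsum_mul_left] at hsq
  simp only [polylogSeries, polylog_eq_tsum 4, one_pow, mul_one]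
  linarith

lemma tsum_sum_range_eq_polylogSeries :
    ∑' m : ℕ, ∑ n ∈ Finset.range m, (-1 : ℝ) ^ (m + n) / ((m : ℝ) ^ 3 * (n : ℝ))
      = polylogSeries (logPartial (-1)) 3 (-1) := by
  have h : ∀ m : ℕ, ∑ n ∈ Finset.range (m + 1),
      (-1 : ℝ) ^ (m + 1 + n) / (((m + 1 : ℕ) : ℝ) ^ 3 * (n : ℝ))
      = logPartial (-1) m * (-1) ^ (m + 1) / ((m : ℝ) + 1) ^ 3 := fun m => by
    rw [Finset.sum_range_succ', logPartial, Finset.sum_mul, Finset.sum_div]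
    simp only [Nat.cast_zero, mul_zero, div_zero, add_zero]
    refine Finset.sum_congr rfl fun n _ => ?_
    push_cast
    rw [pow_add]
    field_simp
  have hs := summable_polylogSeries_three (abs_logPartial_le (x := -1) (by simp)) (x := -1)
    (by simp)
  rw [((summable_nat_add_iff 1).1 (hs.congr fun m => (h m).symm)).tsum_eq_zero_add,
    tsum_congr h, Finset.sum_range_zero, zero_add, polylogSeries]

/-- U(3,1) = Σ_{m>n>0} (−1)^{m+n}/(m³ n)
    = (1/2)ζ(4) − 2(Li₄(1/2) + (1/24)(log 2)²((log 2)² − π²)),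
    where the double sum is taken as an iterated sum (outer over m, inner over n < m). -/
theorem U_three_one :
    (∑' m : ℕ, ∑ n ∈ Finset.range m, (-1 : ℝ) ^ (m + n) / ((m : ℝ) ^ 3 * (n : ℝ)))
      = (1 / 2) * (∑' n : ℕ, (1 : ℝ) / ((n : ℝ) + 1) ^ 4)
        - 2 * ((∑' n : ℕ, ((1 : ℝ) / 2) ^ (n + 1) / ((n : ℝ) + 1) ^ 4)
          + (1 / 24) * (Real.log 2) ^ 2 * ((Real.log 2) ^ 2 - Real.pi ^ 2)) := by
  have hz : ∑' n : ℕ, (1 : ℝ) / ((n : ℝ) + 1) ^ 4 = polylog 4 1 := by simp [polylog_eq_tsum]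
  rw [tsum_sum_range_eq_polylogSeries, hz, ← polylog_eq_tsum]
  have hd := polylogSeries_logPartial_distribution
  rw [polylogSeries_logPartial_one_neg_one, polylogSeries_signedHarmonic_three,
    polylogSeries_logPartial_neg_one_one, polylogSeries_logPartial_one_one] at hd
  have e2 : polylog 2 (-1) = -polylog 2 1 / 2 := by
    have h : 2 ^ 2 * (polylog 2 1 + polylog 2 (-1)) = 2 * polylog 2 1 :=
      two_pow_mul_polylog_one_add_polylog_neg_one 0
    linarith
  have e3 : polylog 3 (-1) = -3 / 4 * polylog 3 1 := by
    have h : 2 ^ 3 * (polylog 3 1 + polylog 3 (-1)) = 2 * polylog 3 1 :=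
      two_pow_mul_polylog_one_add_polylog_neg_one 1
    linarith
  have e4 : polylog 4 (-1) = -7 / 8 * polylog 4 1 := by
    have h : 2 ^ 4 * (polylog 4 1 + polylog 4 (-1)) = 2 * polylog 4 1 :=
      two_pow_mul_polylog_one_add_polylog_neg_one 2
    linarith
  rw [e2, e3, e4, polylog_two_one, polylog_four_one] at hd
  rw [polylog_four_one]
  linear_combination hd
end

section
/- The ε-expansion of F(ε) := (Γ(1+2ε)/(ε³(1−2ε)))·[Γ⁴(1−ε)Γ²(1+ε)/(Γ²(1−2ε)Γ(1+2ε)) − Γ³(1−ε)/Γ(1−3ε)] satisfies lim_{ε→0} F(ε) = 6·ζ(3). -/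
open Filter

/-- The closed form value of the two-loop master integral in D = 4−2ε. -/
noncomputable def Ffun (ε : ℝ) : ℝ :=
  (Real.Gamma (1 + 2 * ε) / (ε ^ 3 * (1 - 2 * ε)))
    * (Real.Gamma (1 - ε) ^ 4 * Real.Gamma (1 + ε) ^ 2
          / (Real.Gamma (1 - 2 * ε) ^ 2 * Real.Gamma (1 + 2 * ε))
        - Real.Gamma (1 - ε) ^ 3 / Real.Gamma (1 - 3 * ε))

open Topology Real in
/-- Third-order Taylor expansion of `log Γ` at `1`, with an explicit remainder bound. -/
theorem abs_log_Gamma_one_add_sub_taylor_le {x : ℝ} (hx : |x| ≤ 1 / 2) :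
    |log (Gamma (1 + x)) - (-eulerMascheroniConstant * x
        + (∑' n : ℕ, 1 / ((n : ℝ) + 1) ^ 2) / 2 * x ^ 2
        - (∑' n : ℕ, 1 / ((n : ℝ) + 1) ^ 3) / 3 * x ^ 3)|
      ≤ 2 * (∑' n : ℕ, 1 / ((n : ℝ) + 1) ^ 4) * x ^ 4 := by
  have hsum (k : ℕ) (hk : 1 < k) : Summable fun n : ℕ => 1 / ((n : ℝ) + 1) ^ k := by
    simpa using (summable_nat_add_iff 1).mpr (Real.summable_one_div_nat_pow.mpr hk)
  have hlim (k : ℕ) (hk : 1 < k) := ((hsum k hk).hasSum.tendsto_sum_nat).comp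
    (tendsto_add_atTop_nat 1)
  have hpos : 0 < 1 + x := by linarith [neg_le_of_abs_le hx]
  have hterm (m : ℕ) : |log (1 + x + m) - log (1 + m)
      - (x * (1 / (m + 1)) - x ^ 2 / 2 * (1 / (m + 1) ^ 2) + x ^ 3 / 3 * (1 / (m + 1) ^ 3))|
      ≤ 2 * x ^ 4 * (1 / ((m : ℝ) + 1) ^ 4) := by
    have hm : (0 : ℝ) < m + 1 := by positivity
    set t := x / (m + 1) with ht
    have ht2 : |t| ≤ 1 / 2 := by
      rw [ht, abs_div, abs_of_pos hm]
      exact (div_le_self (abs_nonneg x) (by simp)).trans hx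
    have key := Real.abs_log_sub_add_sum_range_le (x := -t) (by rw [abs_neg]; linarith) 3
    have hlog : log (1 - -t) = log (1 + x + m) - log (1 + m) := by
      rw [← Real.log_div (by linarith [m.cast_nonneg (α := ℝ)]) (by positivity)]
      congr 1
      rw [ht]
      field_simp
      ring
    have hbound : |-t| ^ (3 + 1) / (1 - |-t|) ≤ 2 * t ^ 4 := by
      rw [abs_neg, show |t| ^ (3 + 1) = t ^ 4 from Even.pow_abs (by decide) t,
        div_le_iff₀ (by linarith)]
      nlinarith [pow_nonneg (abs_nonneg t) 4, Even.pow_nonneg (show Even 4 by decide) t]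
    rw [hlog] at key
    refine (congrArg abs ?_).trans_le ((key.trans hbound).trans_eq ?_)
    · simp only [Finset.sum_range_succ, Finset.sum_range_zero, ht]
      push_cast
      field_simp
      ring
    · rw [ht]
      field_simp
  have hgamma : Tendsto (fun n : ℕ => log n - (harmonic (n + 1) : ℝ)) atTop
      (𝓝 (-eulerMascheroniConstant)) := by
    have h := tendsto_harmonic_sub_log.neg.sub
      (tendsto_one_div_add_atTop_nhds_zero_nat (𝕜 := ℝ))
    rw [sub_zero] at h
    refine h.congr fun n => ?_
    rw [harmonic_succ]
    push_cast
    ring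
  have hseq := (Real.BohrMollerup.tendsto_log_gamma hpos).sub
    (Real.BohrMollerup.tendsto_log_gamma one_pos)
  rw [Real.Gamma_one, Real.log_one, sub_zero] at hseq
  have hlhs := (hseq.sub (((hgamma.mul_const x).add ((hlim 2 (by norm_num)).div_const 2
    |>.mul_const (x ^ 2))).sub ((hlim 3 (by norm_num)).div_const 3 |>.mul_const (x ^ 3)))).abs
  refine le_of_tendsto_of_tendsto' hlhs
    (((hlim 4 (by norm_num)).const_mul 2).mul_const (x ^ 4)) fun n => ?_
  have hharm : (harmonic (n + 1) : ℝ) = ∑ m ∈ Finset.range (n + 1), 1 / ((m : ℝ) + 1) := by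
    simp [harmonic]
  have hsumle := (Finset.abs_sum_le_sum_abs _ _).trans
    (Finset.sum_le_sum fun m (_ : m ∈ Finset.range (n + 1)) => hterm m)
  simp only [Finset.sum_sub_distrib, Finset.sum_add_distrib, ← Finset.mul_sum] at hsumle
  simp only [Function.comp_apply, Real.BohrMollerup.logGammaSeq, hharm]
  rw [abs_sub_comm] at hsumle
  convert hsumle using 1
  · congr 1
    ring
  · ring

/-- The logarithm of the ratio of the two Gamma-function products in `Ffun`. -/
noncomputable def logGammaRatio (ε : ℝ) : ℝ :=
  Real.log (Real.Gamma (1 - ε)) + 2 * Real.log (Real.Gamma (1 + ε))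
    - 2 * Real.log (Real.Gamma (1 - 2 * ε)) - Real.log (Real.Gamma (1 + 2 * ε))
    + Real.log (Real.Gamma (1 - 3 * ε))

theorem abs_logGammaRatio_sub_le {ε : ℝ} (hε : |ε| ≤ 1 / 6) :
    |logGammaRatio ε - 6 * (∑' n : ℕ, (1 : ℝ) / ((n : ℝ) + 1) ^ 3) * ε ^ 3|
      ≤ 264 * (∑' n : ℕ, 1 / ((n : ℝ) + 1) ^ 4) * ε ^ 4 := by
  obtain ⟨hl, hu⟩ := abs_le.mp hε
  have h (k : ℝ) (hk : |k| ≤ 3) := abs_le.mp <|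
    abs_log_Gamma_one_add_sub_taylor_le (x := k * ε) (by
      rw [abs_mul]
      nlinarith [abs_nonneg k, abs_nonneg ε])
  obtain ⟨a1, b1⟩ := h (-1) (by norm_num)
  obtain ⟨a2, b2⟩ := h 1 (by norm_num)
  obtain ⟨a3, b3⟩ := h (-2) (by norm_num)
  obtain ⟨a4, b4⟩ := h 2 (by norm_num)
  obtain ⟨a5, b5⟩ := h (-3) (by norm_num)
  simp only [neg_mul, one_mul, ← sub_eq_add_neg] at a1 a2 a3 a4 a5 b1 b2 b3 b4 b5
  rw [abs_le, logGammaRatio]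
  constructor <;> linarith

theorem tendsto_logGammaRatio_div_cube :
    Tendsto (fun ε => logGammaRatio ε / ε ^ 3) (nhdsWithin 0 {0}ᶜ)
      (nhds (6 * ∑' n : ℕ, (1 : ℝ) / ((n : ℝ) + 1) ^ 3)) := by
  have hzero : Tendsto (fun ε : ℝ => 264 * (∑' n : ℕ, 1 / ((n : ℝ) + 1) ^ 4) * |ε|)
      (nhdsWithin 0 {0}ᶜ) (nhds 0) := by
    refine (Continuous.tendsto' (by fun_prop) 0 0 (by simp)).mono_left nhdsWithin_le_nhds
  rw [tendsto_iff_dist_tendsto_zero]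
  refine squeeze_zero' (.of_forall fun _ => dist_nonneg) ?_ hzero
  filter_upwards [self_mem_nhdsWithin,
    mem_nhdsWithin_of_mem_nhds (Metric.closedBall_mem_nhds (0 : ℝ) (ε := 1 / 6) (by norm_num))]
    with ε hne hball
  have hne : ε ≠ 0 := hne
  have hε : |ε| ≤ 1 / 6 := by simpa using hball
  have hpos : 0 < |ε ^ 3| := abs_pos.mpr (pow_ne_zero 3 hne)
  rw [Real.dist_eq, div_sub' (pow_ne_zero 3 hne), abs_div, div_le_iff₀ hpos, mul_assoc _ |ε|,
    ← abs_mul, ← pow_succ', abs_of_nonneg (Even.pow_nonneg (by decide) ε), mul_comm (ε ^ 3)]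
  exact abs_logGammaRatio_sub_le hε

theorem Ffun_eq_mul_logGammaRatio_div_cube {ε : ℝ} (hne : ε ≠ 0) (hε : |ε| ≤ 1 / 6) :
    Ffun ε = Real.Gamma (1 + 2 * ε) / (1 - 2 * ε)
      * (Real.Gamma (1 - ε) ^ 3 / Real.Gamma (1 - 3 * ε))
      * dslope Real.exp 0 (logGammaRatio ε) * (logGammaRatio ε / ε ^ 3) := by
  obtain ⟨hl, hu⟩ := abs_le.mp hε
  have g1 : 0 < Real.Gamma (1 - ε) := Real.Gamma_pos_of_pos (by linarith)
  have g2 : 0 < Real.Gamma (1 + ε) := Real.Gamma_pos_of_pos (by linarith)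
  have g3 : 0 < Real.Gamma (1 - 2 * ε) := Real.Gamma_pos_of_pos (by linarith)
  have g4 : 0 < Real.Gamma (1 + 2 * ε) := Real.Gamma_pos_of_pos (by linarith)
  have g5 : 0 < Real.Gamma (1 - 3 * ε) := Real.Gamma_pos_of_pos (by linarith)
  have hden : 1 - 2 * ε ≠ 0 := by linarith
  have hexp : Real.exp (logGammaRatio ε) = Real.Gamma (1 - ε) * Real.Gamma (1 + ε) ^ 2
      / Real.Gamma (1 - 2 * ε) ^ 2 / Real.Gamma (1 + 2 * ε) * Real.Gamma (1 - 3 * ε) := by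
    simp only [logGammaRatio, two_mul (Real.log _), Real.exp_add, Real.exp_sub, Real.exp_log g1,
      Real.exp_log g2, Real.exp_log g3, Real.exp_log g4, Real.exp_log g5, ← pow_two]
  have hslope : logGammaRatio ε * dslope Real.exp 0 (logGammaRatio ε)
      = Real.exp (logGammaRatio ε) - 1 := by
    simpa using sub_smul_dslope Real.exp 0 (logGammaRatio ε)
  rw [mul_assoc, ← mul_div_assoc (dslope _ _ _), mul_comm (dslope _ _ _), hslope, hexp, Ffun]
  generalize Real.Gamma (1 - 3 * ε) = G at g5 ⊢
  field_simp

/-- lim_{ε→0} F(ε) = 6·ζ(3). -/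
theorem Ffun_tendsto_six_zeta_three :
    Tendsto Ffun (nhdsWithin 0 {0}ᶜ)
      (nhds (6 * ∑' n : ℕ, (1 : ℝ) / ((n : ℝ) + 1) ^ 3)) := by
  have hGamma (k : ℝ) : ContinuousAt (fun ε => Real.Gamma (1 + k * ε)) 0 := by
    have h1 : ContinuousAt Real.Gamma (1 + k * 0) := by
      rw [mul_zero, add_zero]
      exact Real.hasDerivAt_Gamma_one.continuousAt
    exact ContinuousAt.comp (f := fun ε => 1 + k * ε) h1 (by fun_prop)
  have hGamma_sub (k : ℝ) : ContinuousAt (fun ε => Real.Gamma (1 - k * ε)) 0 := by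
    simpa [← sub_eq_add_neg] using hGamma (-k)
  have hGamma_one : ContinuousAt (fun ε => Real.Gamma (1 - ε)) 0 := by
    simpa using hGamma_sub 1
  have hpre : Tendsto (fun ε => Real.Gamma (1 + 2 * ε) / (1 - 2 * ε)
      * (Real.Gamma (1 - ε) ^ 3 / Real.Gamma (1 - 3 * ε))) (nhdsWithin 0 {0}ᶜ) (nhds 1) := by
    have h : ContinuousAt (fun ε => Real.Gamma (1 + 2 * ε) / (1 - 2 * ε)
        * (Real.Gamma (1 - ε) ^ 3 / Real.Gamma (1 - 3 * ε))) 0 :=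
      ((hGamma 2).div (by fun_prop) (by simp)).mul
        ((hGamma_one.pow 3).div (hGamma_sub 3) (by simp))
    simpa using h.tendsto.mono_left nhdsWithin_le_nhds
  have hratio : Tendsto logGammaRatio (nhdsWithin 0 {0}ᶜ) (nhds 0) := by
    have hcube : Tendsto (fun ε : ℝ => ε ^ 3) (nhdsWithin 0 {0}ᶜ) (nhds 0) :=
      (Continuous.tendsto' (by fun_prop) 0 0 (by simp)).mono_left nhdsWithin_le_nhds
    have h := tendsto_logGammaRatio_div_cube.mul hcube
    rw [mul_zero] at h
    refine h.congr' ?_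
    filter_upwards [self_mem_nhdsWithin] with ε hne
    exact div_mul_cancel₀ _ (pow_ne_zero 3 hne)
  have hslope : Tendsto (fun ε => dslope Real.exp 0 (logGammaRatio ε)) (nhdsWithin 0 {0}ᶜ)
      (nhds 1) := by
    have h := (continuousAt_dslope_same.mpr (Real.differentiableAt_exp (x := 0))).tendsto
    rw [dslope_same, Real.deriv_exp, Real.exp_zero] at h
    exact h.comp hratio
  have hmain := (hpre.mul hslope).mul tendsto_logGammaRatio_div_cube
  rw [one_mul, one_mul] at hmain
  refine hmain.congr' ?_
  filter_upwards [self_mem_nhdsWithin,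
    mem_nhdsWithin_of_mem_nhds (Metric.closedBall_mem_nhds (0 : ℝ) (ε := 1 / 6) (by norm_num))]
    with ε hne hball
  exact (Ffun_eq_mul_logGammaRatio_div_cube hne (by simpa using hball)).symm
end

section
/- For complex parameters a, b, c, e, f in the (generic) domain of convergence, the ₃F₂ transformation holds: ₃F₂(a,b,c;e,f;1) = [Γ(1−a)Γ(e)Γ(f)Γ(c−b)/(Γ(e−b)Γ(f−b)Γ(1+b−a)Γ(c))]·₃F₂(b, b−e+1, b−f+1; 1+b−c, 1+b−a; 1) + (the same term with b and c interchanged), whenever Re(e+f−a−b−c) > 0 and all Gamma factors and hypergeometric series involved are defined and convergent. -/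
/-- The Pochhammer symbol (a)ₖ = a(a+1)⋯(a+k−1). -/
noncomputable def poch (a : ℂ) (k : ℕ) : ℂ := ∏ i ∈ Finset.range k, (a + i)

/-- The term of the ₃F₂ hypergeometric series at unit argument. -/
noncomputable def F32term (a b c e f : ℂ) (k : ℕ) : ℂ :=
  poch a k * poch b k * poch c k / (poch e k * poch f k * (k.factorial : ℂ))

/-- ₃F₂(a,b,c;e,f;1). -/
noncomputable def F32 (a b c e f : ℂ) : ℂ := ∑' k : ℕ, F32term a b c e f k

/-- `z` is not a nonpositive integer. -/
def NotNonposInt (z : ℂ) : Prop := ∀ n : ℕ, z ≠ -n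

open Filter Topology

lemma poch_succ (x : ℂ) (k : ℕ) : poch x (k + 1) = poch x k * (x + k) :=
  Finset.prod_range_succ _ _

lemma poch_add (x : ℂ) (m k : ℕ) : poch x (m + k) = poch x m * poch (x + m) k := by
  simp only [poch, Finset.prod_range_add, Nat.cast_add, add_assoc]

lemma poch_sub_self (x : ℂ) (n : ℕ) : poch (x - n) n = (-1) ^ n * poch (1 - x) n := by
  have h : poch (x - n) n = ∏ i ∈ Finset.range n, (-1) * (1 - x + i) := by
    rw [poch, ← Finset.prod_range_reflect]
    refine Finset.prod_congr rfl fun i hi => ?_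
    have := Finset.mem_range.1 hi
    rw [Nat.sub_sub, Nat.cast_sub (by omega)]
    push_cast
    ring
  rw [h, Finset.prod_mul_distrib, Finset.prod_const, Finset.card_range, poch]

lemma poch_one (k : ℕ) : poch 1 k = (k.factorial : ℂ) := by
  induction k with
  | zero => simp [poch]
  | succ k ih => rw [poch_succ, ih, Nat.factorial_succ]; push_cast; ring

lemma poch_ne_zero {x : ℂ} (hx : NotNonposInt x) (k : ℕ) : poch x k ≠ 0 :=
  Finset.prod_ne_zero_iff.2 fun i _ h => hx i (eq_neg_of_add_eq_zero_left h)

lemma poch_eq_zero {m k : ℕ} (h : m < k) : poch (-m) k = 0 :=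
  Finset.prod_eq_zero (Finset.mem_range.2 h) (by simp)

lemma NotNonposInt.of_im_ne_zero {x : ℂ} (hx : x.im ≠ 0) : NotNonposInt x := by
  rintro n rfl
  simp at hx

lemma NotNonposInt.Gamma_ne_zero {x : ℂ} (hx : NotNonposInt x) : Complex.Gamma x ≠ 0 :=
  Complex.Gamma_ne_zero hx

lemma NotNonposInt.add_natCast {x : ℂ} (hx : NotNonposInt x) (n : ℕ) : NotNonposInt (x + n) := by
  intro m h
  refine hx (m + n) ?_
  push_cast
  linear_combination h

lemma inv_Gamma_eq_poch_mul (x : ℂ) (n : ℕ) :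
    (Complex.Gamma x)⁻¹ = poch x n * (Complex.Gamma (x + n))⁻¹ := by
  induction n with
  | zero => simp [poch]
  | succ n ih =>
    rw [ih, poch_succ, Complex.one_div_Gamma_eq_self_mul_one_div_Gamma_add_one (x + n)]
    push_cast
    ring_nf

lemma tendsto_poch_div (x : ℂ) :
    Tendsto (fun N : ℕ => poch x (N + 1) / ((N : ℂ) ^ x * (N.factorial : ℂ))) atTop
      (𝓝 (Complex.Gamma x)⁻¹) := by
  by_cases hx : NotNonposInt x
  · refine ((Complex.GammaSeq_tendsto_Gamma x).inv₀ hx.Gamma_ne_zero).congr fun N => ?_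
    rw [Complex.GammaSeq, inv_div, poch]
  · obtain ⟨m, rfl⟩ : ∃ m : ℕ, x = -m := by simpa [NotNonposInt] using hx
    rw [Complex.Gamma_neg_nat_eq_zero, inv_zero]
    refine tendsto_const_nhds.congr' ?_
    filter_upwards [eventually_ge_atTop m] with N hN
    rw [poch_eq_zero (by omega), zero_div]

lemma norm_poch_le (x : ℂ) {y : ℂ} (hy : NotNonposInt y) :
    ∃ C : ℝ, 0 < C ∧ ∀ k : ℕ, ‖poch x k‖ ≤ C * ((k : ℝ) + 1) ^ (x.re - y.re) * ‖poch y k‖ := by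
  set u : ℕ → ℝ := fun k => ‖poch x k‖ / (((k : ℝ) + 1) ^ (x.re - y.re) * ‖poch y k‖) with hu
  have h1 : Tendsto (fun N : ℕ => (N : ℝ) / (N + 2)) atTop (𝓝 1) := by
    simpa using tendsto_natCast_div_add_atTop (𝕜 := ℝ) (2 : ℝ)
  have h2 : Tendsto (fun N : ℕ => u (N + 1)) atTop
      (𝓝 (‖(Complex.Gamma x)⁻¹‖ / ‖(Complex.Gamma y)⁻¹‖ * 1 ^ (x.re - y.re))) := by
    refine Tendsto.congr' ?_ ((((tendsto_poch_div x).norm).div (tendsto_poch_div y).norm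
      (by simpa using hy.Gamma_ne_zero)).mul (h1.rpow_const (Or.inl one_ne_zero)))
    filter_upwards [eventually_gt_atTop 0] with N hN
    have hN' : (0 : ℝ) < N := by exact_mod_cast hN
    have hf : (0 : ℝ) < (N.factorial : ℝ) := by exact_mod_cast N.factorial_pos
    have hp : 0 < ‖poch y (N + 1)‖ := norm_pos_iff.2 (poch_ne_zero hy _)
    simp only [hu, Pi.div_apply, norm_div, norm_mul, Complex.norm_natCast_cpow_of_pos hN,
      Complex.norm_natCast]
    rw [Real.div_rpow hN'.le (by positivity), Real.rpow_sub hN']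
    push_cast
    rw [show (N : ℝ) + 1 + 1 = N + 2 by ring]
    have a1 := Real.rpow_pos_of_pos hN' x.re
    have a2 := Real.rpow_pos_of_pos hN' y.re
    have a3 := Real.rpow_pos_of_pos (show (0 : ℝ) < N + 2 by positivity) (x.re - y.re)
    field_simp
  obtain ⟨C, hC⟩ := ((tendsto_add_atTop_iff_nat 1).1 h2).bddAbove_range
  refine ⟨max C 1, by positivity, fun k => ?_⟩
  have hk : u k ≤ max C 1 := (hC ⟨k, rfl⟩).trans (le_max_left _ _)
  have hp : 0 < ‖poch y k‖ := norm_pos_iff.2 (poch_ne_zero hy _)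
  have hq : 0 < ((k : ℝ) + 1) ^ (x.re - y.re) := by positivity
  rw [hu] at hk
  rw [mul_assoc]
  exact (div_le_iff₀ (mul_pos hq hp)).1 hk

/-- A point off the real axis, with the same real part, whose real translates are larger. -/
lemma exists_im_ne_zero_norm_poch_le (x : ℂ) :
    ∃ x' : ℂ, x'.re = x.re ∧ x'.im ≠ 0 ∧
      ∀ (r : ℝ) (k : ℕ), ‖poch (x + r) k‖ ≤ ‖poch (x' + r) k‖ := by
  refine ⟨⟨x.re, |x.im| + 1⟩, rfl, by positivity, fun r k => ?_⟩
  simp only [poch, norm_prod]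
  refine Finset.prod_le_prod (fun _ _ => norm_nonneg _) fun i _ => ?_
  rw [Complex.norm_def, Complex.norm_def]
  apply Real.sqrt_le_sqrt
  simp only [Complex.normSq_apply, Complex.add_re, Complex.add_im, Complex.ofReal_re,
    Complex.ofReal_im, Complex.natCast_re, Complex.natCast_im, add_zero]
  nlinarith [abs_nonneg x.im, sq_abs x.im]

lemma norm_poch_add_natCast_le (x : ℂ) {y : ℂ} (hy : NotNonposInt y) :
    ∃ C : ℝ, 0 < C ∧ ∀ n L : ℕ, ‖poch (x + n) L‖ ≤
      C * (((n : ℝ) + L + 1) / (n + 1)) ^ (x.re - y.re) * ‖poch (y + n) L‖ := by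
  obtain ⟨x', hre, him, hle⟩ := exists_im_ne_zero_norm_poch_le x
  have hx' := NotNonposInt.of_im_ne_zero him
  obtain ⟨A, hA, h1⟩ := norm_poch_le x' hy
  obtain ⟨B, hB, h2⟩ := norm_poch_le y hx'
  rw [hre] at h1 h2
  refine ⟨A * B, by positivity, fun n L => ?_⟩
  have hxx : ‖poch (x + n) L‖ ≤ ‖poch (x' + n) L‖ := by simpa using hle n L
  refine hxx.trans ?_
  have e1 := h1 (n + L)
  have e2 := h2 n
  rw [poch_add, poch_add, norm_mul, norm_mul] at e1
  have p1 : 0 < ‖poch x' n‖ := norm_pos_iff.2 (poch_ne_zero hx' _)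
  have q1 : 0 < ((n : ℝ) + 1) ^ (x.re - y.re) := by positivity
  have q2 : 0 < ((n : ℝ) + L + 1) ^ (x.re - y.re) := by positivity
  have e3 : ((n : ℝ) + 1) ^ (y.re - x.re) = (((n : ℝ) + 1) ^ (x.re - y.re))⁻¹ := by
    rw [← Real.rpow_neg (by positivity), neg_sub]
  rw [e3] at e2
  push_cast at e1
  rw [Real.div_rpow (by positivity) (by positivity)]
  refine le_of_mul_le_mul_left (e1.trans ?_) p1
  calc A * ((n : ℝ) + L + 1) ^ (x.re - y.re) * (‖poch y n‖ * ‖poch (y + n) L‖)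
      ≤ A * ((n : ℝ) + L + 1) ^ (x.re - y.re) *
        ((B * (((n : ℝ) + 1) ^ (x.re - y.re))⁻¹ * ‖poch x' n‖) * ‖poch (y + n) L‖) := by
        gcongr
    _ = _ := by ring

lemma norm_poch_sub_natCast (x : ℂ) {n L : ℕ} (h : n ≤ L) :
    ‖poch (x - n) L‖ = ‖poch (1 - x) n‖ * ‖poch x (L - n)‖ := by
  obtain ⟨k, rfl⟩ := Nat.exists_eq_add_of_le h
  rw [poch_add, poch_sub_self, sub_add_cancel, Nat.add_sub_cancel_left]
  simp

lemma norm_poch_sub_natCast_le (x : ℂ) {y : ℂ} (hy : NotNonposInt y)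
    (hy' : NotNonposInt (1 - y)) :
    ∃ C : ℝ, 0 < C ∧ ∀ n L : ℕ, n ≤ L → ‖poch (x - n) L‖ ≤
      C * (((L : ℝ) - n + 1) / (n + 1)) ^ (x.re - y.re) * ‖poch (y - n) L‖ := by
  obtain ⟨A, hA, h1⟩ := norm_poch_le x hy
  obtain ⟨B, hB, h2⟩ := norm_poch_le (1 - x) hy'
  refine ⟨A * B, by positivity, fun n L hn => ?_⟩
  rw [norm_poch_sub_natCast x hn, norm_poch_sub_natCast y hn]
  have e1 := h1 (L - n)
  have e2 := h2 n
  have hn' : (n : ℝ) ≤ L := by exact_mod_cast hn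
  rw [Nat.cast_sub hn] at e1
  have e3 : ((n : ℝ) + 1) ^ ((1 - x).re - (1 - y).re) = (((n : ℝ) + 1) ^ (x.re - y.re))⁻¹ := by
    rw [← Real.rpow_neg (by positivity)]
    congr 1
    simp
  rw [e3] at e2
  rw [Real.div_rpow (by linarith) (by positivity)]
  have q : 0 ≤ ((L : ℝ) - n + 1) ^ (x.re - y.re) := Real.rpow_nonneg (by linarith) _
  refine (mul_le_mul e2 e1 (norm_nonneg _) (by positivity)).trans (le_of_eq ?_)
  ring

lemma norm_poch_sub_natCast_le_factorial (x : ℂ) :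
    ∃ C : ℝ, 0 < C ∧ ∀ n N : ℕ, n ≤ N → ‖poch (x - n) (N + 1)‖ ≤
      C * (((N : ℝ) + 1 - n + 1) / (n + 1)) ^ x.re * (n.factorial * (N - n).factorial) := by
  have h1 : NotNonposInt 1 := by
    intro n h
    exact Nat.cast_add_one_ne_zero (R := ℂ) n (by linear_combination h)
  obtain ⟨A, hA, h1'⟩ := norm_poch_le x h1
  obtain ⟨B, hB, h2⟩ := norm_poch_le (1 - x) h1
  refine ⟨A * B, by positivity, fun n N hn => ?_⟩
  obtain ⟨k, rfl⟩ := Nat.exists_eq_add_of_le hn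
  rw [norm_poch_sub_natCast x (by omega), show n + k + 1 - n = k + 1 by omega,
    Nat.add_sub_cancel_left]
  have e1 := h1' (k + 1)
  have e2 := h2 n
  rw [poch_one, Complex.norm_natCast] at e1 e2
  have e3 : ((n : ℝ) + 1) ^ ((1 - x).re - (1 : ℂ).re) = (((n : ℝ) + 1) ^ x.re)⁻¹ := by
    rw [← Real.rpow_neg (by positivity)]
    congr 1
    simp
  rw [e3] at e2
  push_cast at e1 ⊢
  rw [show (n : ℝ) + k + 1 - n + 1 = k + 1 + 1 by ring,
    Real.div_rpow (by positivity) (by positivity)]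
  refine (mul_le_mul e2 e1 (norm_nonneg _) (by positivity)).trans ?_
  rw [Real.rpow_sub (by positivity), Complex.one_re, Real.rpow_one, Nat.factorial_succ]
  push_cast
  have q1 : 0 < ((n : ℝ) + 1) ^ x.re := by positivity
  have q2 : 0 < ((k : ℝ) + 1 + 1) ^ x.re := by positivity
  have e4 : ((k : ℝ) + 1) / (k + 1 + 1) ≤ 1 := by
    rw [div_le_one (by positivity)]
    linarith
  calc _ = (A * B * (((k : ℝ) + 1 + 1) ^ x.re / ((n : ℝ) + 1) ^ x.re) *
        (n.factorial * k.factorial)) * (((k : ℝ) + 1) / (k + 1 + 1)) := by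
        field_simp
    _ ≤ _ := mul_le_of_le_one_right (by positivity) e4

lemma rpow_le_four_rpow_abs {t : ℝ} (h1 : 1 / 4 ≤ t) (h2 : t ≤ 4) (p : ℝ) : t ^ p ≤ 4 ^ |p| := by
  rcases le_total 0 p with hp | hp
  · rw [abs_of_nonneg hp]
    exact Real.rpow_le_rpow (by linarith) h2 hp
  · rw [abs_of_nonpos hp, Real.rpow_neg (by norm_num), ← Real.inv_rpow (by norm_num)]
    exact Real.rpow_le_rpow_of_nonpos (by norm_num) (by linarith) hp

lemma rpow_mul_rpow_mul_rpow_le (p q : ℝ) {n N : ℕ} (hN : 0 < N) (hn : n ≤ N)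
    (h : 0 ≤ q ∨ 2 * n ≤ N) :
    (N : ℝ) ^ (-(p + q)) * (((n : ℝ) + (N + 1) + 1) / (n + 1)) ^ p
        * (((N : ℝ) + 1 - n + 1) / (n + 1)) ^ q
      ≤ 4 ^ |p| * 4 ^ |q| * ((n : ℝ) + 1) ^ (-(p + q)) := by
  have hN' : (1 : ℝ) ≤ N := by exact_mod_cast hN
  have hN0 : (0 : ℝ) < N := by linarith
  have hn' : (n : ℝ) ≤ N := by exact_mod_cast hn
  have hn0 : (0 : ℝ) ≤ n := n.cast_nonneg
  have hB : (0 : ℝ) < (N : ℝ) + 1 - n + 1 := by linarith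
  have k1 : (((n : ℝ) + (N + 1) + 1) / N) ^ p ≤ 4 ^ |p| := by
    apply rpow_le_four_rpow_abs
    · rw [le_div_iff₀ hN0]; linarith
    · rw [div_le_iff₀ hN0]; linarith
  have k2 : (((N : ℝ) + 1 - n + 1) / N) ^ q ≤ 4 ^ |q| := by
    rcases h with h | h
    · rw [abs_of_nonneg h]
      refine Real.rpow_le_rpow (by positivity) ?_ h
      rw [div_le_iff₀ hN0]; linarith
    · have h' : 2 * (n : ℝ) ≤ N := by exact_mod_cast h
      apply rpow_le_four_rpow_abs
      · rw [le_div_iff₀ hN0]; linarith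
      · rw [div_le_iff₀ hN0]; linarith
  have hpos : (0 : ℝ) ≤ (((N : ℝ) + 1 - n + 1) / N) ^ q := by positivity
  have key := mul_le_mul k1 k2 hpos (by positivity)
  refine (le_of_eq ?_).trans
    (mul_le_mul_of_nonneg_right key (by positivity : 0 ≤ ((n : ℝ) + 1) ^ (-(p + q))))
  rw [Real.div_rpow (by positivity) (by positivity), Real.div_rpow (by positivity) (by positivity),
    Real.div_rpow (by positivity) (by positivity), Real.div_rpow (by positivity) (by positivity),
    Real.rpow_neg (by positivity), Real.rpow_neg (by positivity), Real.rpow_add (by positivity),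
    Real.rpow_add (by positivity)]
  field_simp

open Polynomial in
lemma sum_prod_sub_div_prod_erase {ι : Type*} [DecidableEq ι] {s : Finset ι} (hs : s.Nonempty)
    (u : ι → ℂ) {v : ι → ℂ} (hv : Set.InjOn v s) :
    ∑ i ∈ s, (∏ j ∈ s, (v i - u j)) / ∏ j ∈ s.erase i, (v i - v j)
      = ∑ i ∈ s, v i - ∑ i ∈ s, u i := by
  have hm : ∀ w : ι → ℂ, (∏ j ∈ s, (X - C (w j))).Monic := fun w =>
    monic_prod_of_monic _ _ fun j _ => monic_X_sub_C _
  have hd : ∀ w : ι → ℂ, (∏ j ∈ s, (X - C (w j))).natDegree = s.card := fun w => by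
    rw [natDegree_prod_of_monic _ _ fun j _ => monic_X_sub_C _]
    simp
  have hc : ∀ w : ι → ℂ, (∏ j ∈ s, (X - C (w j))).coeff (s.card - 1) = -∑ j ∈ s, w j := by
    intro w
    rw [← prod_X_sub_C_nextCoeff, nextCoeff_of_natDegree_pos, hd]
    rw [hd]
    exact hs.card_pos
  have hdeg : (∏ j ∈ s, (X - C (u j)) - ∏ j ∈ s, (X - C (v j))).degree < (s.card : WithBot ℕ) := by
    have hu := degree_eq_natDegree (hm u).ne_zero
    have hv' := degree_eq_natDegree (hm v).ne_zero
    rw [hd] at hu hv'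
    rw [← hu]
    exact degree_sub_lt_left (hu.trans hv'.symm) (hm u).ne_zero
      ((hm u).leadingCoeff.trans (hm v).leadingCoeff.symm)
  have key := Lagrange.coeff_eq_sum hv hdeg
  rw [coeff_sub, hc, hc] at key
  rw [show ∑ i ∈ s, v i - ∑ i ∈ s, u i = -∑ i ∈ s, u i - -∑ i ∈ s, v i by ring, key]
  refine Finset.sum_congr rfl fun i hi => ?_
  simp only [eval_sub, eval_prod, eval_X, eval_C]
  rw [Finset.prod_eq_zero (f := fun j => v i - v j) hi (sub_self _), sub_zero]

lemma prod_range_ite_sub {n N : ℕ} (h : n ≤ N) :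
    ∏ j ∈ Finset.range (N + 1), (if j = n then 1 else (j : ℂ) - (n : ℂ))
      = (-1) ^ n * n.factorial * (N - n).factorial := by
  obtain ⟨k, rfl⟩ := Nat.exists_eq_add_of_le h
  rw [add_assoc, Finset.prod_range_add, Finset.prod_range_succ', Nat.add_sub_cancel_left]
  have h1 : ∏ j ∈ Finset.range n, (if j = n then 1 else (j : ℂ) - (n : ℂ))
      = (-1) ^ n * n.factorial := by
    have h3 := poch_sub_self 0 n
    rw [sub_zero, poch_one] at h3
    rw [← h3, poch]
    refine Finset.prod_congr rfl fun j hj => ?_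
    rw [if_neg (Finset.mem_range.1 hj).ne]
    ring
  have h2 : ∏ j ∈ Finset.range k, (if n + (j + 1) = n then 1
      else ((n + (j + 1) : ℕ) : ℂ) - (n : ℂ)) = k.factorial := by
    rw [← poch_one k, poch]
    refine Finset.prod_congr rfl fun j hj => ?_
    rw [if_neg (by omega)]
    push_cast
    ring
  rw [h1, h2]
  simp

lemma prod_range_ite_sub' {n N : ℕ} (h : n ≤ N) :
    ∏ j ∈ Finset.range (N + 1), (if j = n then 1 else (n : ℂ) - (j : ℂ))
      = (-1) ^ N * ((-1) ^ n * n.factorial * (N - n).factorial) := by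
  have h1 : (∏ j ∈ Finset.range (N + 1), (if j = n then 1 else (n : ℂ) - (j : ℂ))) * (-1) =
      (∏ j ∈ Finset.range (N + 1), (if j = n then 1 else (j : ℂ) - (n : ℂ))) * (-1) ^ (N + 1) := by
    have h2 : (-1 : ℂ) = ∏ j ∈ Finset.range (N + 1), (if j = n then -1 else 1) := by
      rw [Finset.prod_ite_eq', if_pos (Finset.mem_range.2 (by omega))]
    have h3 : ((-1 : ℂ)) ^ (N + 1) = ∏ j ∈ Finset.range (N + 1), (-1) := by simp
    rw [h3]
    nth_rewrite 1 [h2]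
    rw [← Finset.prod_mul_distrib, ← Finset.prod_mul_distrib]
    refine Finset.prod_congr rfl fun j _ => ?_
    split_ifs <;> ring
  rw [prod_range_ite_sub h] at h1
  rw [pow_succ] at h1
  linear_combination -h1

/-- The product of Pochhammer symbols approximating a residue, before scaling. -/
noncomputable def pochResidue (x₁ x₂ x₃ y₁ y₂ : ℂ) (N n : ℕ) : ℂ :=
  poch x₁ (N + 1) * poch x₂ (N + 1) * poch x₃ (N + 1) /
    (poch y₁ (N + 1) * poch y₂ (N + 1) * ((-1) ^ n * n.factorial * (N - n).factorial))

lemma prod_range_sub_eq_poch (x z : ℂ) (N : ℕ) :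
    ∏ j ∈ Finset.range (N + 1), (z - (x + j)) = (-1) ^ (N + 1) * poch (x - z) (N + 1) := by
  have h : ((-1 : ℂ)) ^ (N + 1) = ∏ j ∈ Finset.range (N + 1), (-1) := by simp
  rw [h, poch, ← Finset.prod_mul_distrib]
  exact Finset.prod_congr rfl fun j _ => by ring

lemma prod_range_sub_natCast (z : ℂ) (N : ℕ) :
    ∏ j ∈ Finset.range (N + 1), (z - j) = (-1) ^ (N + 1) * poch (-z) (N + 1) := by
  simpa using prod_range_sub_eq_poch 0 z N

lemma prod_range_neg_sub_eq_poch (x z : ℂ) (N : ℕ) :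
    ∏ j ∈ Finset.range (N + 1), (z - (-x - j)) = poch (x + z) (N + 1) :=
  Finset.prod_congr rfl fun j _ => by ring

lemma prod_erase_eq_prod_ite {ι : Type*} [DecidableEq ι] {s : Finset ι} (i : ι) (g : ι → ℂ) :
    ∏ j ∈ s.erase i, g j = ∏ j ∈ s, if j = i then 1 else g j := by
  rw [← Finset.prod_subset (Finset.erase_subset i s)]
  · exact Finset.prod_congr rfl fun j hj => by rw [if_neg (Finset.ne_of_mem_erase hj)]
  · intro j hj hj'
    rw [if_pos]
    by_contra h
    exact hj' (Finset.mem_erase.2 ⟨h, hj⟩)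

/-- The sum of the residues of a rational function equals its residue at infinity. -/
lemma sum_pochResidue (a b c e f : ℂ) (hb : NotNonposInt b) (hc : NotNonposInt c)
    (hbc : ∀ m n : ℕ, b + m ≠ c + n) (N : ℕ) :
    ∑ n ∈ Finset.range (N + 1),
        (pochResidue (1 - a + b + n) (e - b - n) (f - b - n) (b + n) (c - b - n) N n
        + pochResidue (1 - a + c + n) (e - c - n) (f - c - n) (c + n) (b - c - n) N n
        - pochResidue (e + n) (f + n) (1 - a - n) (b + n) (c + n) N n)
      = (N + 1) * (a - 1 + e + f - b - c) := by
  classical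
  set s : Finset (Fin 3 × ℕ) := Finset.univ ×ˢ Finset.range (N + 1) with hs
  set v : Fin 3 × ℕ → ℂ := fun p => ![(0 + (p.2 : ℂ)), -b - p.2, -c - p.2] p.1 with hv
  set u : Fin 3 × ℕ → ℂ := fun p => ![1 - a + (p.2 : ℂ), -e - p.2, -f - p.2] p.1 with hu
  have hinj : Set.InjOn v s := by
    rintro ⟨i, m⟩ - ⟨j, n⟩ - h
    have hb' : ∀ m n : ℕ, (m : ℂ) ≠ -b - n := fun m n h =>
      hb (m + n) (by push_cast; linear_combination h)
    have hc' : ∀ m n : ℕ, (m : ℂ) ≠ -c - n := fun m n h =>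
      hc (m + n) (by push_cast; linear_combination h)
    have hbc' : ∀ m n : ℕ, -b - m ≠ -c - n := fun m n h =>
      hbc m n (by linear_combination -h)
    fin_cases i <;> fin_cases j <;> simp [hv] at h ⊢
    · exact h
    · exact hb' _ _ h
    · exact hc' _ _ h
    · exact hb' _ _ h.symm
    · exact h
    · exact hbc' _ _ h
    · exact hc' _ _ h.symm
    · exact hbc' _ _ h.symm
    · exact h
  have hne : s.Nonempty := ⟨(0, 0), by simp [hs]⟩
  have key := sum_prod_sub_div_prod_erase hne u hinj
  simp only [prod_erase_eq_prod_ite] at key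
  simp only [hs, Finset.sum_product, Finset.prod_product, Fin.sum_univ_three,
    Fin.prod_univ_three, hv, hu, Prod.mk.injEq] at key
  simp only [Matrix.cons_val_zero, Matrix.cons_val_one, Matrix.cons_val, Fin.isValue,
    Fin.reduceEq, false_and, true_and, if_false, prod_range_sub_eq_poch,
    prod_range_neg_sub_eq_poch, sub_sub_sub_cancel_left, zero_add,
    prod_range_sub_natCast] at key
  have hpow := neg_one_pow_eq_or ℂ N
  rw [Finset.sum_sub_distrib, Finset.sum_add_distrib]
  have k0 : ∀ n ∈ Finset.range (N + 1),
      (-1) ^ (N + 1) * poch (1 - a - n) (N + 1) * poch (e + n) (N + 1) * poch (f + n) (N + 1) /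
        ((∏ j ∈ Finset.range (N + 1), if j = n then 1 else (n : ℂ) - j) *
          poch (b + n) (N + 1) * poch (c + n) (N + 1))
        = -pochResidue (e + n) (f + n) (1 - a - n) (b + n) (c + n) N n := by
    intro n hn
    rw [prod_range_ite_sub' (Finset.mem_range_succ_iff.1 hn), pochResidue, pow_succ]
    rcases hpow with h | h <;> rw [h] <;> ring
  have k1 : ∀ d d' : ℂ, ∀ n ∈ Finset.range (N + 1),
      (-1) ^ (N + 1) * poch (1 - a - (-d - n)) (N + 1) * poch (e + (-d - n)) (N + 1) *
        poch (f + (-d - n)) (N + 1) /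
        ((-1) ^ (N + 1) * poch (-(-d - n)) (N + 1) *
          (∏ j ∈ Finset.range (N + 1), if j = n then 1 else (j : ℂ) - n) *
            poch (d' + (-d - n)) (N + 1))
        = pochResidue (1 - a + d + n) (e - d - n) (f - d - n) (d + n) (d' - d - n) N n := by
    intro d d' n hn
    rw [prod_range_ite_sub (Finset.mem_range_succ_iff.1 hn), pochResidue, pow_succ,
      show 1 - a - (-d - n) = 1 - a + d + n by ring, show e + (-d - n) = e - d - n by ring,
      show f + (-d - n) = f - d - n by ring, show d' + (-d - n) = d' - d - n by ring,
      show -(-d - (n : ℂ)) = d + n by ring]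
    rcases hpow with h | h <;> rw [h] <;> ring
  have k2 : ∀ n ∈ Finset.range (N + 1),
      (-1) ^ (N + 1) * poch (1 - a - (-c - n)) (N + 1) * poch (e + (-c - n)) (N + 1) *
        poch (f + (-c - n)) (N + 1) /
        ((-1) ^ (N + 1) * poch (-(-c - n)) (N + 1) * poch (b + (-c - n)) (N + 1) *
          ∏ j ∈ Finset.range (N + 1), if j = n then 1 else (j : ℂ) - n)
        = pochResidue (1 - a + c + n) (e - c - n) (f - c - n) (c + n) (b - c - n) N n := by
    intro n hn
    rw [mul_right_comm ((-1 : ℂ) ^ (N + 1) * poch (-(-c - n)) (N + 1))]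
    exact k1 c b n hn
  rw [Finset.sum_congr rfl k0, Finset.sum_congr rfl (k1 b c), Finset.sum_congr rfl k2] at key
  have hsum : ∑ x ∈ Finset.range (N + 1), (x : ℂ) + ∑ x ∈ Finset.range (N + 1), (-b - (x : ℂ)) +
        ∑ x ∈ Finset.range (N + 1), (-c - (x : ℂ)) -
      (∑ x ∈ Finset.range (N + 1), (1 - a + (x : ℂ)) + ∑ x ∈ Finset.range (N + 1), (-e - (x : ℂ)) +
        ∑ x ∈ Finset.range (N + 1), (-f - (x : ℂ))) = (N + 1) * (a - 1 + e + f - b - c) := by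
    simp only [← Finset.sum_add_distrib, ← Finset.sum_sub_distrib]
    rw [Finset.sum_congr rfl fun x _ =>
      show _ = a - 1 + e + f - b - c by ring, Finset.sum_const, Finset.card_range, nsmul_eq_mul]
    push_cast
    ring
  rw [hsum, Finset.sum_neg_distrib] at key
  rw [← key]
  ring

lemma tendsto_factorial_div_pow_mul_factorial (n : ℕ) :
    Tendsto (fun N : ℕ => (N.factorial : ℂ) / ((N : ℂ) ^ n * (N - n).factorial)) atTop (𝓝 1) := by
  induction n with
  | zero =>
    refine tendsto_const_nhds.congr fun N => ?_
    have := N.factorial_ne_zero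
    simp [this]
  | succ n ih =>
    have h1 : Tendsto (fun N : ℕ => 1 - (n : ℂ) / N) atTop (𝓝 (1 - 0)) :=
      tendsto_const_nhds.sub (tendsto_const_div_atTop_nhds_zero_nat (n : ℂ))
    have h2 := ih.mul h1
    rw [sub_zero, mul_one] at h2
    refine h2.congr' ?_
    filter_upwards [eventually_gt_atTop n] with N hN
    obtain ⟨k, rfl⟩ := Nat.exists_eq_add_of_lt hN
    rw [show n + k + 1 - n = k + 1 by omega, show n + k + 1 - (n + 1) = k by omega,
      Nat.factorial_succ k]
    have hN0 : ((n + k + 1 : ℕ) : ℂ) ≠ 0 := Nat.cast_ne_zero.2 (Nat.succ_ne_zero (n + k))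
    have hk : ((k : ℂ) + 1) ≠ 0 := Nat.cast_add_one_ne_zero k
    have hf : (k.factorial : ℂ) ≠ 0 := by exact_mod_cast k.factorial_ne_zero
    push_cast at hN0 ⊢
    field_simp
    ring

/-- The residue of a product of Gamma functions at a simple pole. -/
noncomputable def gammaResidue (x₁ x₂ x₃ y₁ y₂ : ℂ) (n : ℕ) : ℂ :=
  (-1) ^ n / n.factorial * ((Complex.Gamma x₁)⁻¹ * (Complex.Gamma x₂)⁻¹ * (Complex.Gamma x₃)⁻¹ *
    (Complex.Gamma y₁ * Complex.Gamma y₂))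

lemma tendsto_pochResidue (x₁ x₂ x₃ : ℂ) {y₁ y₂ : ℂ} (h₁ : NotNonposInt y₁)
    (h₂ : NotNonposInt y₂) (n : ℕ) {z : ℂ} (hz : z = x₁ + x₂ + x₃ - y₁ - y₂ + n) :
    Tendsto (fun N : ℕ => (N : ℂ) ^ (-z) * pochResidue x₁ x₂ x₃ y₁ y₂ N n) atTop
      (𝓝 (gammaResidue x₁ x₂ x₃ y₁ y₂ n)) := by
  have t₁ := (tendsto_poch_div y₁).inv₀ (inv_ne_zero h₁.Gamma_ne_zero)
  have t₂ := (tendsto_poch_div y₂).inv₀ (inv_ne_zero h₂.Gamma_ne_zero)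
  rw [inv_inv] at t₁ t₂
  have t := ((((tendsto_poch_div x₁).mul (tendsto_poch_div x₂)).mul (tendsto_poch_div x₃)).mul
    (t₁.mul t₂)).const_mul ((-1 : ℂ) ^ n / n.factorial) |>.mul
      (tendsto_factorial_div_pow_mul_factorial n)
  rw [mul_one] at t
  refine t.congr' ?_
  filter_upwards [eventually_gt_atTop 0] with N hN
  have hN0 : (N : ℂ) ≠ 0 := by exact_mod_cast hN.ne'
  have hf : (N.factorial : ℂ) ≠ 0 := by exact_mod_cast N.factorial_ne_zero
  have hf' : ((N - n).factorial : ℂ) ≠ 0 := by exact_mod_cast (N - n).factorial_ne_zero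
  have hfn : (n.factorial : ℂ) ≠ 0 := by exact_mod_cast n.factorial_ne_zero
  have hp₁ := poch_ne_zero h₁ (N + 1)
  have hp₂ := poch_ne_zero h₂ (N + 1)
  have hc : ∀ x : ℂ, (N : ℂ) ^ x ≠ 0 := fun x => by simp [Complex.cpow_eq_zero_iff, hN0]
  have hc₁ := hc x₁
  have hc₂ := hc x₂
  have hc₃ := hc x₃
  have hc₄ := hc y₁
  have hc₅ := hc y₂
  rw [Complex.cpow_neg, hz, Complex.cpow_add _ _ hN0, Complex.cpow_sub _ _ hN0,
    Complex.cpow_sub _ _ hN0, Complex.cpow_add _ _ hN0, Complex.cpow_add _ _ hN0,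
    Complex.cpow_natCast, pochResidue]
  have hs : ((-1 : ℂ)) ^ n * (-1) ^ n = 1 := by rw [← mul_pow]; simp
  have hs' : ((-1 : ℂ)) ^ n ≠ 0 := by simp
  field_simp
  rw [sq, hs, one_mul]

lemma summable_add_one_rpow_neg {r : ℝ} (hr : 1 < r) :
    Summable fun n : ℕ => ((n : ℝ) + 1) ^ (-r) := by
  have := (summable_nat_add_iff 1).2 (Real.summable_nat_rpow.2 (neg_lt_neg hr))
  simpa using this

lemma tendsto_sum_range_of_le_rpow {t : ℕ → ℕ → ℂ} {g : ℕ → ℂ} {C r : ℝ} (hr : 1 < r)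
    (hC : 0 ≤ C) (ht : ∀ n, Tendsto (t · n) atTop (𝓝 (g n)))
    (hb : ∀ n N, 0 < N → n ≤ N → ‖t N n‖ ≤ C * ((n : ℝ) + 1) ^ (-r)) :
    Tendsto (fun N => ∑ n ∈ Finset.range (N + 1), t N n) atTop (𝓝 (∑' n, g n)) := by
  have key := tendsto_tsum_of_dominated_convergence (𝓕 := atTop)
    (f := fun N n => if n ∈ Finset.range (N + 1) then t N n else 0) (g := g)
    ((summable_add_one_rpow_neg hr).mul_left C) ?_ ?_
  · refine key.congr fun N => ?_
    rw [tsum_eq_sum (s := Finset.range (N + 1)) (fun n hn => if_neg hn)]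
    exact Finset.sum_congr rfl fun n hn => if_pos hn
  · intro n
    refine (ht n).congr' ?_
    filter_upwards [eventually_ge_atTop n] with N hN
    rw [if_pos (Finset.mem_range_succ_iff.2 hN)]
  · filter_upwards [eventually_gt_atTop 0] with N hN n
    split_ifs with h
    · exact hb n N hN (Finset.mem_range_succ_iff.1 h)
    · rw [norm_zero]
      positivity

lemma summable_of_tendsto_of_le_rpow {t : ℕ → ℕ → ℂ} {g : ℕ → ℂ} {C r : ℝ} (hr : 1 < r)
    (ht : ∀ n, Tendsto (t · n) atTop (𝓝 (g n)))
    (hb : ∀ n N, 0 < N → 2 * n ≤ N → ‖t N n‖ ≤ C * ((n : ℝ) + 1) ^ (-r)) : Summable g := by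
  refine Summable.of_norm_bounded ((summable_add_one_rpow_neg hr).mul_left C) fun n => ?_
  refine le_of_tendsto (ht n).norm ?_
  filter_upwards [eventually_gt_atTop 0, eventually_ge_atTop (2 * n)] with N h1 h2
  exact hb n N h1 h2

/-- The residues at the nonnegative integers. -/
noncomputable def upResidue (a b c e f : ℂ) (n : ℕ) : ℂ :=
  gammaResidue (e + n) (f + n) (1 - a - n) (b + n) (c + n) n

/-- The residues at the points `-b - n`. -/
noncomputable def downResidue (a b c e f : ℂ) (n : ℕ) : ℂ :=
  gammaResidue (1 - a + b + n) (e - b - n) (f - b - n) (b + n) (c - b - n) n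

lemma exists_norm_upResidue_le (a : ℂ) {b c : ℂ} (e f : ℂ) (hb : NotNonposInt b)
    (hc : NotNonposInt c) {z : ℂ} (hz : z.re = (e + f - b - c).re + (1 - a).re) :
    ∃ C : ℝ, 0 ≤ C ∧ ∀ n N : ℕ, 0 < N → n ≤ N → (0 ≤ (1 - a).re ∨ 2 * n ≤ N) →
      ‖(N : ℂ) ^ (-z) * pochResidue (e + n) (f + n) (1 - a - n) (b + n) (c + n) N n‖
        ≤ C * ((n : ℝ) + 1) ^ (-z.re) := by
  obtain ⟨C₁, h₁, H₁⟩ := norm_poch_add_natCast_le e hb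
  obtain ⟨C₂, h₂, H₂⟩ := norm_poch_add_natCast_le f hc
  obtain ⟨C₃, h₃, H₃⟩ := norm_poch_sub_natCast_le_factorial (1 - a)
  set p := (e + f - b - c).re with hp
  set q := (1 - a).re with hq
  refine ⟨C₁ * C₂ * C₃ * (4 ^ |p| * 4 ^ |q|), by positivity, fun n N hN hn h => ?_⟩
  have G₁ := H₁ n (N + 1)
  have G₂ := H₂ n (N + 1)
  have G₃ := H₃ n N hn
  have key := rpow_mul_rpow_mul_rpow_le p q hN hn h
  push_cast at G₁ G₂
  rw [pochResidue, norm_mul, Complex.norm_natCast_cpow_of_pos hN, Complex.neg_re]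
  simp only [norm_mul, norm_div, norm_pow, norm_neg, norm_one, one_pow, one_mul,
    Complex.norm_natCast]
  have hn' : (n : ℝ) ≤ N := by exact_mod_cast hn
  have hQ : (0 : ℝ) < ((N : ℝ) + 1 - n + 1) / (n + 1) := div_pos (by linarith) (by positivity)
  have p₁ : 0 < ‖poch (b + n) (N + 1)‖ := norm_pos_iff.2 (poch_ne_zero (hb.add_natCast n) _)
  have p₂ : 0 < ‖poch (c + n) (N + 1)‖ := norm_pos_iff.2 (poch_ne_zero (hc.add_natCast n) _)
  have p₃ : (0 : ℝ) < n.factorial * (N - n).factorial := by positivity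
  have hpow : (((n : ℝ) + (N + 1) + 1) / (n + 1)) ^ p
      = (((n : ℝ) + (N + 1) + 1) / (n + 1)) ^ (e.re - b.re)
        * (((n : ℝ) + (N + 1) + 1) / (n + 1)) ^ (f.re - c.re) := by
    rw [← Real.rpow_add (by positivity)]
    congr 1
    simp [hp]
    ring
  rw [hpow] at key
  rw [hz]
  have := mul_le_mul (mul_le_mul G₁ G₂ (norm_nonneg _) (by positivity)) G₃ (norm_nonneg _)
    (by positivity)
  have h4 : ‖poch (e + n) (N + 1)‖ * ‖poch (f + n) (N + 1)‖ * ‖poch (1 - a - n) (N + 1)‖ /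
      (‖poch (b + n) (N + 1)‖ * ‖poch (c + n) (N + 1)‖ * (n.factorial * (N - n).factorial))
      ≤ C₁ * C₂ * C₃ * ((((n : ℝ) + (N + 1) + 1) / (n + 1)) ^ (e.re - b.re)
        * (((n : ℝ) + (N + 1) + 1) / (n + 1)) ^ (f.re - c.re)
        * (((N : ℝ) + 1 - n + 1) / (n + 1)) ^ q) := by
    rw [div_le_iff₀ (by positivity)]
    refine this.trans (le_of_eq ?_)
    ring
  refine (mul_le_mul_of_nonneg_left h4 (by positivity)).trans ?_
  refine (le_of_eq ?_).trans ((mul_le_mul_of_nonneg_left key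
    (by positivity : 0 ≤ C₁ * C₂ * C₃)).trans (le_of_eq ?_)) <;> ring

lemma exists_norm_downResidue_le (a : ℂ) {b c : ℂ} (e f : ℂ) (hb : NotNonposInt b)
    (hcb : NotNonposInt (c - b)) (hbc : NotNonposInt (1 - (c - b))) {z : ℂ}
    (hz : z.re = (1 - a).re + (e + f - b - c).re) :
    ∃ C : ℝ, 0 ≤ C ∧ ∀ n N : ℕ, 0 < N → n ≤ N → (0 ≤ (e + f - b - c).re ∨ 2 * n ≤ N) →
      ‖(N : ℂ) ^ (-z) *
        pochResidue (1 - a + b + n) (e - b - n) (f - b - n) (b + n) (c - b - n) N n‖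
        ≤ C * ((n : ℝ) + 1) ^ (-z.re) := by
  obtain ⟨C₁, h₁, H₁⟩ := norm_poch_add_natCast_le (1 - a + b) hb
  obtain ⟨C₂, h₂, H₂⟩ := norm_poch_sub_natCast_le (e - b) hcb hbc
  obtain ⟨C₃, h₃, H₃⟩ := norm_poch_sub_natCast_le_factorial (f - b)
  set q := (e + f - b - c).re with hq
  set p := (1 - a).re with hp
  refine ⟨C₁ * C₂ * C₃ * (4 ^ |p| * 4 ^ |q|), by positivity, fun n N hN hn h => ?_⟩
  have G₁ := H₁ n (N + 1)
  have G₂ := H₂ n (N + 1) (by omega)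
  have G₃ := H₃ n N hn
  have key := rpow_mul_rpow_mul_rpow_le p q hN hn h
  push_cast at G₁ G₂
  rw [pochResidue, norm_mul, Complex.norm_natCast_cpow_of_pos hN, Complex.neg_re]
  simp only [norm_mul, norm_div, norm_pow, norm_neg, norm_one, one_pow, one_mul,
    Complex.norm_natCast]
  have hn' : (n : ℝ) ≤ N := by exact_mod_cast hn
  have hQ : (0 : ℝ) < ((N : ℝ) + 1 - n + 1) / (n + 1) := div_pos (by linarith) (by positivity)
  have p₁ : 0 < ‖poch (b + n) (N + 1)‖ := norm_pos_iff.2 (poch_ne_zero (hb.add_natCast n) _)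
  have p₂ : 0 < ‖poch (c - b - n) (N + 1)‖ := by
    rw [norm_poch_sub_natCast _ (by omega)]
    exact mul_pos (norm_pos_iff.2 (poch_ne_zero hbc _)) (norm_pos_iff.2 (poch_ne_zero hcb _))
  have p₃ : (0 : ℝ) < n.factorial * (N - n).factorial := by positivity
  have hp' : (1 - a + b).re - b.re = p := by simp [hp]
  have hpow : (((N : ℝ) + 1 - n + 1) / (n + 1)) ^ q
      = (((N : ℝ) + 1 - n + 1) / (n + 1)) ^ ((e - b).re - (c - b).re)
        * (((N : ℝ) + 1 - n + 1) / (n + 1)) ^ (f - b).re := by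
    rw [← Real.rpow_add hQ]
    congr 1
    simp [hq]
    ring
  rw [hp'] at G₁
  rw [hpow] at key
  rw [hz]
  have := mul_le_mul (mul_le_mul G₁ G₂ (norm_nonneg _) (by positivity)) G₃ (norm_nonneg _)
    (by positivity)
  have h4 : ‖poch (1 - a + b + n) (N + 1)‖ * ‖poch (e - b - n) (N + 1)‖
      * ‖poch (f - b - n) (N + 1)‖ /
      (‖poch (b + n) (N + 1)‖ * ‖poch (c - b - n) (N + 1)‖ * (n.factorial * (N - n).factorial))
      ≤ C₁ * C₂ * C₃ * ((((n : ℝ) + (N + 1) + 1) / (n + 1)) ^ p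
        * ((((N : ℝ) + 1 - n + 1) / (n + 1)) ^ ((e - b).re - (c - b).re)
        * (((N : ℝ) + 1 - n + 1) / (n + 1)) ^ (f - b).re)) := by
    rw [div_le_iff₀ (by positivity)]
    refine this.trans (le_of_eq ?_)
    ring
  refine (mul_le_mul_of_nonneg_left h4 (by positivity)).trans ?_
  refine (le_of_eq ?_).trans ((mul_le_mul_of_nonneg_left key
    (by positivity : 0 ≤ C₁ * C₂ * C₃)).trans (le_of_eq ?_)) <;> ring

lemma NotNonposInt.sub_natCast {x : ℂ} (hx : NotNonposInt x) (hx' : NotNonposInt (1 - x))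
    (n : ℕ) : NotNonposInt (x - n) := by
  intro m h
  rcases le_or_gt n m with hnm | hnm
  · obtain ⟨k, rfl⟩ := Nat.exists_eq_add_of_le hnm
    refine hx k ?_
    push_cast at h
    linear_combination h
  · obtain ⟨k, rfl⟩ := Nat.exists_eq_add_of_lt hnm
    refine hx' k ?_
    push_cast at h
    linear_combination -h

lemma tendsto_scaled_upResidue (a : ℂ) {b c : ℂ} (e f : ℂ) (hb : NotNonposInt b)
    (hc : NotNonposInt c) (n : ℕ) :
    Tendsto (fun N : ℕ => (N : ℂ) ^ (-(1 + (e + f - a - b - c))) *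
      pochResidue (e + n) (f + n) (1 - a - n) (b + n) (c + n) N n) atTop
      (𝓝 (upResidue a b c e f n)) :=
  tendsto_pochResidue _ _ _ (hb.add_natCast n) (hc.add_natCast n) n (by ring)

lemma tendsto_scaled_downResidue (a : ℂ) {b c : ℂ} (e f : ℂ) (hb : NotNonposInt b)
    (hcb : NotNonposInt (c - b)) (hbc : NotNonposInt (1 - (c - b))) (n : ℕ) :
    Tendsto (fun N : ℕ => (N : ℂ) ^ (-(1 + (e + f - a - b - c))) *
      pochResidue (1 - a + b + n) (e - b - n) (f - b - n) (b + n) (c - b - n) N n) atTop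
      (𝓝 (downResidue a b c e f n)) :=
  tendsto_pochResidue _ _ _ (hb.add_natCast n) (hcb.sub_natCast hbc n) n (by ring)

lemma one_lt_re {s : ℂ} (hs : 0 < s.re) : 1 < (1 + s).re := by simpa using hs

lemma summable_upResidue {a b c e f : ℂ} (hb : NotNonposInt b) (hc : NotNonposInt c)
    (hs : 0 < (e + f - a - b - c).re) : Summable (upResidue a b c e f) := by
  obtain ⟨C, -, H⟩ := exists_norm_upResidue_le a e f hb hc
    (z := 1 + (e + f - a - b - c)) (by simp; ring)
  exact summable_of_tendsto_of_le_rpow (one_lt_re hs) (tendsto_scaled_upResidue a e f hb hc)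
    fun n N hN h => H n N hN (by omega) (Or.inr h)

lemma summable_downResidue {a b c e f : ℂ} (hb : NotNonposInt b)
    (hcb : NotNonposInt (c - b)) (hbc : NotNonposInt (1 - (c - b)))
    (hs : 0 < (e + f - a - b - c).re) : Summable (downResidue a b c e f) := by
  obtain ⟨C, -, H⟩ := exists_norm_downResidue_le a e f hb hcb hbc
    (z := 1 + (e + f - a - b - c)) (by simp; ring)
  exact summable_of_tendsto_of_le_rpow (one_lt_re hs)
    (tendsto_scaled_downResidue a e f hb hcb hbc) fun n N hN h => H n N hN (by omega) (Or.inr h)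

lemma NotNonposInt.one_sub_sub {x y : ℂ} (h : NotNonposInt (y - x)) :
    NotNonposInt (1 - (x - y)) := by
  have := h.add_natCast 1
  rwa [Nat.cast_one, show y - x + 1 = 1 - (x - y) by ring] at this

/-- The sum of the residues, with signs. -/
noncomputable def residueSum (a b c e f : ℂ) : ℂ :=
  ∑' n, downResidue a b c e f n + ∑' n, downResidue a c b e f n - ∑' n, upResidue a b c e f n

lemma tendsto_cpow_neg_mul_add_one_mul {s : ℂ} (hs : 0 < s.re) (z : ℂ) :
    Tendsto (fun N : ℕ => (N : ℂ) ^ (-(1 + s)) * ((N + 1) * z)) atTop (𝓝 0) := by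
  have h1 : Tendsto (fun N : ℕ => ((N : ℝ)) ^ (-s.re)) atTop (𝓝 0) :=
    (tendsto_rpow_neg_atTop hs).comp tendsto_natCast_atTop_atTop
  have h2 : Tendsto (fun N : ℕ => (N : ℂ) ^ (-s)) atTop (𝓝 0) := by
    rw [tendsto_zero_iff_norm_tendsto_zero]
    refine h1.congr' ?_
    filter_upwards [eventually_gt_atTop 0] with N hN
    rw [Complex.norm_natCast_cpow_of_pos hN, Complex.neg_re]
  have h3 : Tendsto (fun N : ℕ => 1 + 1 / (N : ℂ)) atTop (𝓝 (1 + 0)) :=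
    tendsto_const_nhds.add (tendsto_const_div_atTop_nhds_zero_nat (1 : ℂ))
  have h4 := h2.mul (h3.mul_const z)
  rw [zero_mul] at h4
  refine h4.congr' ?_
  filter_upwards [eventually_gt_atTop 0] with N hN
  have hN0 : (N : ℂ) ≠ 0 := Nat.cast_ne_zero.2 hN.ne'
  rw [neg_add, Complex.cpow_add _ _ hN0, Complex.cpow_neg_one]
  field_simp

lemma residueSum_eq_zero_of_nonneg {a b c e f : ℂ} (hb : NotNonposInt b) (hc : NotNonposInt c)
    (hcb : NotNonposInt (c - b)) (hbc : NotNonposInt (b - c))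
    (hs : 0 < (e + f - a - b - c).re) (ha : 0 ≤ (1 - a).re) (hef : 0 ≤ (e + f - b - c).re) :
    residueSum a b c e f = 0 := by
  have hne : ∀ m n : ℕ, b + m ≠ c + n := by
    intro m n h
    rcases le_total m n with hmn | hmn
    · obtain ⟨k, rfl⟩ := Nat.exists_eq_add_of_le hmn
      refine hcb k ?_
      push_cast at h
      linear_combination -h
    · obtain ⟨k, rfl⟩ := Nat.exists_eq_add_of_le hmn
      refine hbc k ?_
      push_cast at h
      linear_combination h
  have hr := one_lt_re hs
  obtain ⟨C₁, h₁, H₁⟩ := exists_norm_downResidue_le a e f hb hcb hbc.one_sub_sub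
    (z := 1 + (e + f - a - b - c)) (by simp; ring)
  obtain ⟨C₂, h₂, H₂⟩ := exists_norm_downResidue_le a e f hc hbc hcb.one_sub_sub
    (z := 1 + (e + f - a - b - c)) (by simp; ring)
  obtain ⟨C₃, h₃, H₃⟩ := exists_norm_upResidue_le a e f hb hc
    (z := 1 + (e + f - a - b - c)) (by simp; ring)
  have T₁ := tendsto_sum_range_of_le_rpow hr h₁
    (tendsto_scaled_downResidue a e f hb hcb hbc.one_sub_sub)
    fun n N hN hn => H₁ n N hN hn (Or.inl hef)
  have T₂ := tendsto_sum_range_of_le_rpow hr h₂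
    (fun n => by
      have := tendsto_scaled_downResidue a e f hc hbc hcb.one_sub_sub n
      rwa [sub_right_comm _ c b] at this)
    fun n N hN hn => H₂ n N hN hn (Or.inl (by rwa [sub_right_comm]))
  have T₃ := tendsto_sum_range_of_le_rpow hr h₃ (tendsto_scaled_upResidue a e f hb hc)
    fun n N hN hn => H₃ n N hN hn (Or.inl ha)
  refine tendsto_nhds_unique ((T₁.add T₂).sub T₃) ?_
  refine (tendsto_cpow_neg_mul_add_one_mul hs (a - 1 + e + f - b - c)).congr fun N => ?_
  rw [← sum_pochResidue a b c e f hb hc hne N, Finset.mul_sum, ← Finset.sum_add_distrib,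
    ← Finset.sum_sub_distrib]
  exact Finset.sum_congr rfl fun n _ => by ring

lemma inv_Gamma_mul_add_inv_Gamma_mul (x y : ℂ) :
    (Complex.Gamma x)⁻¹ * (Complex.Gamma y)⁻¹ + (Complex.Gamma (x - 1))⁻¹ *
      (Complex.Gamma (y + 1))⁻¹
      = (x + y - 1) * ((Complex.Gamma x)⁻¹ * (Complex.Gamma (y + 1))⁻¹) := by
  have h := Complex.one_div_Gamma_eq_self_mul_one_div_Gamma_add_one (x - 1)
  rw [sub_add_cancel] at h
  rw [Complex.one_div_Gamma_eq_self_mul_one_div_Gamma_add_one y, h]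
  ring

lemma upResidue_add (a b c e f : ℂ) (n : ℕ) :
    upResidue a b c e f n + upResidue (a - 1) b c (e - 1) f n
      = (e - a) * upResidue (a - 1) b c e f n := by
  have h := inv_Gamma_mul_add_inv_Gamma_mul (e + n) (1 - a - n)
  simp only [upResidue, gammaResidue]
  rw [show e - 1 + (n : ℂ) = e + n - 1 by ring, show 1 - (a - 1) - (n : ℂ) = 1 - a - n + 1 by ring]
  linear_combination ((-1) ^ n / n.factorial * (Complex.Gamma (f + n))⁻¹ *
    (Complex.Gamma (b + n) * Complex.Gamma (c + n))) * h

lemma downResidue_add (a b c e f : ℂ) (n : ℕ) :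
    downResidue a b c e f n + downResidue (a - 1) b c (e - 1) f n
      = (e - a) * downResidue (a - 1) b c e f n := by
  have h := inv_Gamma_mul_add_inv_Gamma_mul (e - b - n) (1 - a + b + n)
  simp only [downResidue, gammaResidue]
  rw [show e - 1 - b - (n : ℂ) = e - b - n - 1 by ring,
    show 1 - (a - 1) + b + (n : ℂ) = 1 - a + b + n + 1 by ring]
  linear_combination ((-1) ^ n / n.factorial * (Complex.Gamma (f - b - n))⁻¹ *
    (Complex.Gamma (b + n) * Complex.Gamma (c - b - n))) * h

lemma tsum_add_tsum_eq_mul_tsum {u v w : ℕ → ℂ} {k : ℂ} (hu : Summable u) (hv : Summable v)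
    (h : ∀ n, u n + v n = k * w n) : ∑' n, u n + ∑' n, v n = k * ∑' n, w n := by
  rw [← hu.tsum_add hv, ← tsum_mul_left]
  exact tsum_congr h

lemma residueSum_add {a b c e f : ℂ} (hb : NotNonposInt b) (hc : NotNonposInt c)
    (hcb : NotNonposInt (c - b)) (hbc : NotNonposInt (b - c))
    (hs : 0 < (e + f - a - b - c).re) :
    residueSum a b c e f + residueSum (a - 1) b c (e - 1) f
      = (e - a) * residueSum (a - 1) b c e f := by
  have hs' : 0 < (e - 1 + f - (a - 1) - b - c).re := by
    rwa [show e - 1 + f - (a - 1) - b - c = e + f - a - b - c by ring]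
  have h₁ := tsum_add_tsum_eq_mul_tsum (summable_downResidue hb hcb hbc.one_sub_sub hs)
    (summable_downResidue hb hcb hbc.one_sub_sub hs') (downResidue_add a b c e f)
  have h₂ := tsum_add_tsum_eq_mul_tsum
    (summable_downResidue hc hbc hcb.one_sub_sub (by rwa [sub_right_comm]))
    (summable_downResidue hc hbc hcb.one_sub_sub (by rwa [sub_right_comm]))
    (downResidue_add a c b e f)
  have h₃ := tsum_add_tsum_eq_mul_tsum (summable_upResidue hb hc hs)
    (summable_upResidue hb hc hs') (upResidue_add a b c e f)
  simp only [residueSum]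
  linear_combination h₁ + h₂ - h₃

lemma residueSum_eq_zero {a b c e f : ℂ} (hb : NotNonposInt b) (hc : NotNonposInt c)
    (hcb : NotNonposInt (c - b)) (hbc : NotNonposInt (b - c))
    (hs : 0 < (e + f - a - b - c).re) : residueSum a b c e f = 0 := by
  obtain ⟨m, hm⟩ := exists_nat_ge (max (-(1 - a).re) (-(e + f - b - c).re))
  obtain ⟨ha, he⟩ := max_le_iff.1 hm
  clear hm
  induction m generalizing a e with
  | zero =>
    refine residueSum_eq_zero_of_nonneg hb hc hcb hbc hs ?_ ?_
    · simpa using ha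
    · simpa using he
  | succ m ih =>
    push_cast at ha he
    simp only [Complex.sub_re, Complex.add_re, Complex.one_re] at ha he hs ih
    rcases lt_or_ge (1 - a).re 0 with h | h
    · have h' := h
      simp only [Complex.sub_re, Complex.one_re] at h'
      have ha' : (a - 1).re = a.re - 1 := by simp
      have he' : (e - 1).re = e.re - 1 := by simp
      have h₁ := residueSum_add (a := a) (e := e) (f := f) hb hc hcb hbc
        (by simp only [Complex.sub_re, Complex.add_re]; linarith)
      rw [ih (a := a - 1) (e := e - 1), ih (a := a - 1) (e := e)] at h₁
      · simpa using h₁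
      all_goals linarith
    rcases lt_or_ge (e + f - b - c).re 0 with h'' | h''
    · have h' := h''
      simp only [Complex.sub_re, Complex.add_re] at h'
      have ha' : (a + 1).re = a.re + 1 := by simp
      have he' : (e + 1).re = e.re + 1 := by simp
      have h₁ := residueSum_add (a := a + 1) (e := e + 1) (f := f) hb hc hcb hbc
        (by simp only [Complex.sub_re, Complex.add_re]; linarith)
      rw [add_sub_cancel_right, add_sub_cancel_right,
        ih (a := a + 1) (e := e + 1), ih (a := a) (e := e + 1)] at h₁
      · simpa using h₁
      all_goals linarith
    · exact residueSum_eq_zero_of_nonneg hb hc hcb hbc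
        (by simpa only [Complex.sub_re, Complex.add_re] using hs) h h''

lemma Gamma_add_natCast {x : ℂ} (hx : NotNonposInt x) (n : ℕ) :
    Complex.Gamma (x + n) = poch x n * Complex.Gamma x := by
  have h := inv_Gamma_eq_poch_mul x n
  have h₁ := hx.Gamma_ne_zero
  have h₂ := (hx.add_natCast n).Gamma_ne_zero
  field_simp at h
  rw [h, mul_comm]

lemma inv_Gamma_add_natCast {x : ℂ} (hx : NotNonposInt x) (n : ℕ) :
    (Complex.Gamma (x + n))⁻¹ = (Complex.Gamma x)⁻¹ / poch x n := by
  rw [Gamma_add_natCast hx, mul_inv, div_eq_mul_inv, mul_comm]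

lemma inv_Gamma_sub_natCast (x : ℂ) (n : ℕ) :
    (Complex.Gamma (x - n))⁻¹ = (-1) ^ n * poch (1 - x) n * (Complex.Gamma x)⁻¹ := by
  rw [inv_Gamma_eq_poch_mul (x - n) n, sub_add_cancel, poch_sub_self]

lemma Gamma_sub_natCast (x : ℂ) (n : ℕ) :
    Complex.Gamma (x - n) = (-1) ^ n * Complex.Gamma x / poch (1 - x) n := by
  rw [← inv_inv (Complex.Gamma (x - n)), inv_Gamma_sub_natCast, mul_inv, mul_inv, inv_inv,
    ← inv_pow, inv_neg_one]
  ring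

lemma upResidue_eq {a b c e f : ℂ} (hb : NotNonposInt b) (hc : NotNonposInt c)
    (he : NotNonposInt e) (hf : NotNonposInt f) (n : ℕ) :
    upResidue a b c e f n = (Complex.Gamma b * Complex.Gamma c * (Complex.Gamma e)⁻¹ *
      (Complex.Gamma f)⁻¹ * (Complex.Gamma (1 - a))⁻¹) * F32term a b c e f n := by
  have hs : ((-1 : ℂ)) ^ n * (-1) ^ n = 1 := by rw [← mul_pow]; simp
  rw [upResidue, gammaResidue, inv_Gamma_add_natCast he, inv_Gamma_add_natCast hf,
    inv_Gamma_sub_natCast, Gamma_add_natCast hb, Gamma_add_natCast hc, F32term, sub_sub_cancel]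
  simp only [div_eq_mul_inv, mul_inv]
  linear_combination (Complex.Gamma b * Complex.Gamma c * (Complex.Gamma e)⁻¹ *
      (Complex.Gamma f)⁻¹ * (Complex.Gamma (1 - a))⁻¹ * poch a n * poch b n * poch c n *
      (poch e n)⁻¹ * (poch f n)⁻¹ * (n.factorial : ℂ)⁻¹) * hs

lemma downResidue_eq {a b : ℂ} (c e f : ℂ) (hb : NotNonposInt b) (hba : NotNonposInt (1 + b - a))
    (n : ℕ) :
    downResidue a b c e f n = (Complex.Gamma b * Complex.Gamma (c - b) *
      (Complex.Gamma (e - b))⁻¹ * (Complex.Gamma (f - b))⁻¹ * (Complex.Gamma (1 + b - a))⁻¹) *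
      F32term b (b - e + 1) (b - f + 1) (1 + b - c) (1 + b - a) n := by
  have hs : ((-1 : ℂ)) ^ n * (-1) ^ n = 1 := by rw [← mul_pow]; simp
  rw [downResidue, gammaResidue, show 1 - a + b = 1 + b - a by ring, inv_Gamma_add_natCast hba,
    inv_Gamma_sub_natCast, inv_Gamma_sub_natCast, Gamma_add_natCast hb, Gamma_sub_natCast,
    F32term, show 1 - (e - b) = b - e + 1 by ring, show 1 - (f - b) = b - f + 1 by ring,
    show 1 - (c - b) = 1 + b - c by ring]
  simp only [div_eq_mul_inv, mul_inv]
  linear_combination (Complex.Gamma b * Complex.Gamma (c - b) *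
      (Complex.Gamma (e - b))⁻¹ * (Complex.Gamma (f - b))⁻¹ * (Complex.Gamma (1 + b - a))⁻¹ *
      poch b n * poch (b - e + 1) n * poch (b - f + 1) n * (poch (1 + b - c) n)⁻¹ *
      (poch (1 + b - a) n)⁻¹ * (n.factorial : ℂ)⁻¹ * ((-1) ^ n * (-1) ^ n + 1)) * hs

/-- The ₃F₂(1) transformation formula. -/
theorem F32_transformation (a b c e f : ℂ)
    (hconv : 0 < (e + f - a - b - c).re)
    (hsum1 : Summable (F32term a b c e f))
    (hsum2 : Summable (F32term b (b - e + 1) (b - f + 1) (1 + b - c) (1 + b - a)))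
    (hsum3 : Summable (F32term c (c - e + 1) (c - f + 1) (1 + c - b) (1 + c - a)))
    (h1 : NotNonposInt (1 - a)) (h2 : NotNonposInt e) (h3 : NotNonposInt f)
    (h4 : NotNonposInt b) (h5 : NotNonposInt c)
    (h6 : NotNonposInt (c - b)) (h7 : NotNonposInt (b - c))
    (h8 : NotNonposInt (e - b)) (h9 : NotNonposInt (f - b))
    (h10 : NotNonposInt (e - c)) (h11 : NotNonposInt (f - c))
    (h12 : NotNonposInt (1 + b - a)) (h13 : NotNonposInt (1 + c - a))
    (h14 : NotNonposInt (1 + b - c)) (h15 : NotNonposInt (1 + c - b)) :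
    F32 a b c e f
      = Complex.Gamma (1 - a) * Complex.Gamma e * Complex.Gamma f * Complex.Gamma (c - b)
          / (Complex.Gamma (e - b) * Complex.Gamma (f - b) * Complex.Gamma (1 + b - a)
              * Complex.Gamma c)
          * F32 b (b - e + 1) (b - f + 1) (1 + b - c) (1 + b - a)
        + Complex.Gamma (1 - a) * Complex.Gamma e * Complex.Gamma f * Complex.Gamma (b - c)
          / (Complex.Gamma (e - c) * Complex.Gamma (f - c) * Complex.Gamma (1 + c - a)
              * Complex.Gamma b)
          * F32 c (c - e + 1) (c - f + 1) (1 + c - b) (1 + c - a) := by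
  have key := residueSum_eq_zero h4 h5 h6 h7 hconv
  simp only [residueSum, upResidue_eq h4 h5 h2 h3, downResidue_eq c e f h4 h12,
    downResidue_eq b e f h5 h13, tsum_mul_left] at key
  rw [← F32, ← F32, ← F32] at key
  have := h1.Gamma_ne_zero
  have := h2.Gamma_ne_zero
  have := h3.Gamma_ne_zero
  have := h4.Gamma_ne_zero
  have := h5.Gamma_ne_zero
  have := h8.Gamma_ne_zero
  have := h9.Gamma_ne_zero
  have := h10.Gamma_ne_zero
  have := h11.Gamma_ne_zero
  have := h12.Gamma_ne_zero
  have := h13.Gamma_ne_zero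
  field_simp at key ⊢
  linear_combination -key
end

section
/- For complex a, b, c, f in the region where all series converge and no Gamma factor is singular: Σ_{p=0}^∞ Γ(p+a)Γ(p+c)/(p!·Γ(p+f)) · 1/(p+b) = Γ(a)Γ(1−a)Γ(b)Γ(c−b)/(Γ(f−b)Γ(1+b−a)) − [Γ(1−a)Γ(a)/(Γ(f−c)Γ(1+c−f))]·Σ_{p=0}^∞ Γ(p+c−f+1)Γ(p+c)/(p!·Γ(p+1+c−a)) · 1/(p+c−b). -/
open Complex Filter Topology

namespace NotNonposInt

theorem ne_zero {z : ℂ} (h : NotNonposInt z) : z ≠ 0 := by simpa using h 0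

theorem add_one {z : ℂ} (h : NotNonposInt z) : NotNonposInt (z + 1) := fun n hn =>
  h (n + 1) (by push_cast; linear_combination hn)

theorem add_nat {z : ℂ} (h : NotNonposInt z) (n : ℕ) : NotNonposInt (z + n) := by
  induction n with
  | zero => simpa using h
  | succ n ih => convert ih.add_one using 1; push_cast; ring

theorem nat_add_ne_zero {z : ℂ} (h : NotNonposInt z) (n : ℕ) : (n : ℂ) + z ≠ 0 := by
  rw [add_comm]; exact (h.add_nat n).ne_zero

theorem Gamma_nat_add_ne_zero {z : ℂ} (h : NotNonposInt z) (n : ℕ) : Gamma (n + z) ≠ 0 := by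
  rw [add_comm]; exact Gamma_ne_zero (h.add_nat n)

theorem of_re_pos {z : ℂ} (h : 0 < z.re) : NotNonposInt z := fun n hn => by
  have : (0 : ℝ) ≤ n := n.cast_nonneg
  rw [hn] at h
  simp at h
  linarith

end NotNonposInt

theorem Gamma_nat_add_eq_prod {s : ℂ} (hs : NotNonposInt s) (n : ℕ) :
    Gamma (n + s) = Gamma s * ∏ j ∈ Finset.range n, (s + j) := by
  induction n with
  | zero => simp
  | succ n ih =>
    rw [Finset.prod_range_succ, ← mul_assoc, ← ih, mul_comm, add_comm s,
      ← Gamma_add_one _ (hs.nat_add_ne_zero n)]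
    congr 1; push_cast; ring

theorem tendsto_Gamma_nat_add_div {s : ℂ} (hs : NotNonposInt s) :
    Tendsto (fun n : ℕ => Gamma (n + s) / (n.factorial * ((n + 1 : ℕ) : ℂ) ^ (s - 1)))
      atTop (𝓝 1) := by
  have hΓ : Gamma s ≠ 0 := Gamma_ne_zero hs
  have hlim : ∀ w : ℂ, Tendsto (fun n : ℕ => ((n + 1 : ℕ) : ℂ) / (n + w)) atTop (𝓝 1) := by
    intro w
    have h := (tendsto_natCast_div_add_atTop (𝕜 := ℂ) (w - 1)).comp (tendsto_add_atTop_nat 1)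
    refine h.congr fun n => ?_
    simp only [Function.comp_apply]
    congr 1; push_cast; ring
  have h := ((GammaSeq_tendsto_Gamma s).comp (tendsto_add_atTop_nat 1)).inv₀ hΓ
  have h' := (h.const_mul (Gamma s)).mul ((hlim s).mul (hlim (s + 1)))
  rw [mul_inv_cancel₀ hΓ, one_mul, one_mul] at h'
  refine h'.congr fun n => ?_
  have hn : ((n + 1 : ℕ) : ℂ) ≠ 0 := by exact_mod_cast n.succ_ne_zero
  have hP : ∏ j ∈ Finset.range n, (s + j) ≠ 0 := fun h0 =>
    hs.Gamma_nat_add_ne_zero n (by rw [Gamma_nat_add_eq_prod hs, h0, mul_zero])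
  have e1 := hs.nat_add_ne_zero n
  have e2 := hs.add_one.nat_add_ne_zero n
  have e3 : ((n + 1 : ℕ) : ℂ) ^ (s - 1) ≠ 0 := by
    rw [cpow_def_of_ne_zero hn]; exact exp_ne_zero _
  have e4 : (n.factorial : ℂ) ≠ 0 := by exact_mod_cast n.factorial_ne_zero
  simp only [Function.comp_apply, GammaSeq]
  rw [Finset.prod_range_succ, Finset.prod_range_succ, Gamma_nat_add_eq_prod hs,
    show s + ((n + 1 : ℕ) : ℂ) = n + (s + 1) by push_cast; ring, add_comm s (n : ℂ),
    show ((n + 1 : ℕ) : ℂ) ^ s = ((n + 1 : ℕ) : ℂ) ^ (s - 1) * ((n + 1 : ℕ) : ℂ) by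
      rw [cpow_sub _ _ hn, cpow_one]; field_simp, Nat.factorial_succ]
  push_cast at *
  field_simp

theorem exists_Gamma_nat_add_bounds {s : ℂ} (hs : NotNonposInt s) :
    ∃ C > 0, ∀ n : ℕ, ‖Gamma (n + s)‖ ≤ C * (n.factorial * ((n : ℝ) + 1) ^ (s.re - 1)) ∧
      n.factorial * ((n : ℝ) + 1) ^ (s.re - 1) ≤ C * ‖Gamma (n + s)‖ := by
  have h := tendsto_Gamma_nat_add_div hs
  obtain ⟨A, hA⟩ := h.norm.bddAbove_range
  obtain ⟨B, hB⟩ := (h.inv₀ one_ne_zero).norm.bddAbove_range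
  have hnorm : ∀ n : ℕ, ‖(n.factorial * ((n + 1 : ℕ) : ℂ) ^ (s - 1) : ℂ)‖
      = n.factorial * ((n : ℝ) + 1) ^ (s.re - 1) := fun n => by
    rw [norm_mul, norm_natCast_cpow_of_pos n.succ_pos]
    simp
  refine ⟨max 1 (max A B), by positivity, fun n => ⟨?_, ?_⟩⟩
  · have h1 := hA ⟨n, rfl⟩
    have hpos : 0 < n.factorial * ((n : ℝ) + 1) ^ (s.re - 1) := by positivity
    simp only [norm_div, hnorm] at h1
    rw [div_le_iff₀ hpos] at h1
    refine h1.trans ?_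
    gcongr
    simp
  · have h1 := hB ⟨n, rfl⟩
    have hpos : 0 < ‖Gamma (n + s)‖ := norm_pos_iff.2 (hs.Gamma_nat_add_ne_zero n)
    simp only [norm_div, hnorm, inv_div] at h1
    rw [div_le_iff₀ hpos] at h1
    refine h1.trans ?_
    gcongr
    simp

theorem exists_Gamma_ratio_bound {s w : ℂ} (hs : NotNonposInt s) (hw : NotNonposInt w) :
    ∃ C > 0, ∀ n : ℕ, ‖Gamma (n + s) / Gamma (n + w)‖ ≤ C * ((n : ℝ) + 1) ^ (s.re - w.re) := by
  obtain ⟨A, hA, hA'⟩ := exists_Gamma_nat_add_bounds hs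
  obtain ⟨B, hB, hB'⟩ := exists_Gamma_nat_add_bounds hw
  refine ⟨A * B, by positivity, fun n => ?_⟩
  have hpos : 0 < ‖Gamma (n + w)‖ := norm_pos_iff.2 (hw.Gamma_nat_add_ne_zero n)
  rw [norm_div, div_le_iff₀ hpos]
  calc ‖Gamma (n + s)‖ ≤ A * (n.factorial * ((n : ℝ) + 1) ^ (s.re - 1)) := (hA' n).1
    _ = A * ((n : ℝ) + 1) ^ (s.re - w.re) * (n.factorial * ((n : ℝ) + 1) ^ (w.re - 1)) := by
      rw [show s.re - 1 = (s.re - w.re) + (w.re - 1) by ring, Real.rpow_add (by positivity)]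
      ring
    _ ≤ A * ((n : ℝ) + 1) ^ (s.re - w.re) * (B * ‖Gamma (n + w)‖) := by
      exact mul_le_mul_of_nonneg_left (hB' n).2 (by positivity)
    _ = _ := by ring

theorem exists_inv_nat_add_bound {b : ℂ} (hb : NotNonposInt b) :
    ∃ C > 0, ∀ n : ℕ, ‖1 / (n + b)‖ ≤ C * ((n : ℝ) + 1) ^ (-1 : ℝ) := by
  obtain ⟨C, hC, h⟩ := exists_Gamma_ratio_bound hb hb.add_one
  refine ⟨C, hC, fun n => ?_⟩
  convert h n using 2
  · rw [← add_assoc, Gamma_add_one _ (hb.nat_add_ne_zero n)]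
    have := hb.Gamma_nat_add_ne_zero n
    have := hb.nat_add_ne_zero n
    field_simp
  · simp

/-- The products of Gamma quotients with balanced arguments tend to one. -/
theorem tendsto_Gamma_ratio {s t u v : ℂ} (hs : NotNonposInt s) (ht : NotNonposInt t)
    (hu : NotNonposInt u) (hv : NotNonposInt v) (h : s + t = u + v) :
    Tendsto (fun n : ℕ => Gamma (n + s) * Gamma (n + t) / (Gamma (n + u) * Gamma (n + v)))
      atTop (𝓝 1) := by
  have H := ((tendsto_Gamma_nat_add_div hs).mul (tendsto_Gamma_nat_add_div ht)).div
    ((tendsto_Gamma_nat_add_div hu).mul (tendsto_Gamma_nat_add_div hv)) (by simp)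
  simp only [mul_one, div_one] at H
  refine H.congr fun n => ?_
  have hn : ((n + 1 : ℕ) : ℂ) ≠ 0 := by exact_mod_cast n.succ_ne_zero
  have e : ∀ w : ℂ, ((n + 1 : ℕ) : ℂ) ^ w ≠ 0 := fun w => by
    rw [cpow_def_of_ne_zero hn]; exact exp_ne_zero _
  have e4 : (n.factorial : ℂ) ≠ 0 := by exact_mod_cast n.factorial_ne_zero
  have hp : ((n + 1 : ℕ) : ℂ) ^ (s - 1) * ((n + 1 : ℕ) : ℂ) ^ (t - 1)
      = ((n + 1 : ℕ) : ℂ) ^ (u - 1) * ((n + 1 : ℕ) : ℂ) ^ (v - 1) := by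
    rw [← cpow_add _ _ hn, ← cpow_add _ _ hn]
    congr 1; linear_combination h
  simp only [Pi.div_apply]
  have e1 := e (u - 1)
  have e2 := e (v - 1)
  have hcancel : ∀ x y z w N p q : ℂ, N ≠ 0 → p ≠ 0 → q ≠ 0 → ∀ p' q' : ℂ, p' * q' = p * q →
      x / (N * p') * (y / (N * q')) / (z / (N * p) * (w / (N * q))) = x * y / (z * w) := by
    intro x y z w N p q hN hp hq p' q' h
    rw [div_mul_div_comm, div_mul_div_comm, show N * p' * (N * q') = N * p * (N * q) by
      linear_combination N ^ 2 * h, div_div_div_cancel_right₀ (by positivity)]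
  exact hcancel _ _ _ _ _ _ _ e4 e1 e2 _ _ hp

theorem summable_nat_add_one_rpow {x : ℝ} :
    (Summable fun n : ℕ => ((n : ℝ) + 1) ^ x) ↔ x < -1 := by
  rw [← Real.summable_nat_rpow, ← summable_nat_add_iff (f := fun n : ℕ => (n : ℝ) ^ x) 1]
  simp

/-- The general term of Gauss's hypergeometric series at `1`, normalized by Gamma factors. -/
noncomputable def gaussTerm (a c f : ℂ) (p : ℕ) : ℂ :=
  Gamma (p + a) * Gamma (p + c) / (p.factorial * Gamma (p + f))

theorem notNonposInt_one : NotNonposInt 1 := .of_re_pos (by simp)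

theorem gaussTerm_eq_ratio (a c f : ℂ) (p : ℕ) :
    gaussTerm a c f p = Gamma (p + a) / Gamma (p + 1) * (Gamma (p + c) / Gamma (p + f)) := by
  rw [gaussTerm, Gamma_nat_eq_factorial, div_mul_div_comm]

theorem exists_gaussTerm_bound {a c f : ℂ} (ha : NotNonposInt a) (hc : NotNonposInt c)
    (hf : NotNonposInt f) :
    ∃ C > 0, ∀ p : ℕ, ‖gaussTerm a c f p‖ ≤ C * ((p : ℝ) + 1) ^ ((a + c - f).re - 1) := by
  obtain ⟨A, hA, hA'⟩ := exists_Gamma_ratio_bound ha notNonposInt_one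
  obtain ⟨B, hB, hB'⟩ := exists_Gamma_ratio_bound hc hf
  refine ⟨A * B, by positivity, fun p => ?_⟩
  rw [gaussTerm_eq_ratio, norm_mul]
  refine (mul_le_mul (hA' p) (hB' p) (norm_nonneg _) (by positivity)).trans_eq ?_
  rw [mul_mul_mul_comm, ← Real.rpow_add (by positivity)]
  congr 2
  simp
  ring

theorem summable_gaussTerm {a c f : ℂ} (ha : NotNonposInt a) (hc : NotNonposInt c)
    (hf : NotNonposInt f) (h : (a + c - f).re < 0) : Summable (gaussTerm a c f) := by
  obtain ⟨C, -, hC⟩ := exists_gaussTerm_bound ha hc hf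
  exact .of_norm_bounded ((summable_nat_add_one_rpow.2 (by linarith)).mul_left C) hC

theorem gaussTerm_eq_mul_add_one {a c f : ℂ} (hf : NotNonposInt f) (p : ℕ) :
    gaussTerm a c f p = (p + f) * gaussTerm a c (f + 1) p := by
  have h1 := hf.nat_add_ne_zero p
  rw [gaussTerm, gaussTerm, ← add_assoc, Gamma_add_one _ h1]
  field_simp

theorem succ_mul_gaussTerm_succ {a c f : ℂ} (ha : NotNonposInt a) (hc : NotNonposInt c) (p : ℕ) :
    ((p + 1 : ℕ) : ℂ) * gaussTerm a c f (p + 1) = (p + a) * (p + c) * gaussTerm a c (f + 1) p := by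
  have h : ∀ z : ℂ, ((p + 1 : ℕ) : ℂ) + z = p + z + 1 := fun z => by push_cast; ring
  have hp : ((p + 1 : ℕ) : ℂ) ≠ 0 := by exact_mod_cast p.succ_ne_zero
  rw [gaussTerm, gaussTerm, h, h, h, ← add_assoc, Gamma_add_one _ (ha.nat_add_ne_zero p),
    Gamma_add_one _ (hc.nat_add_ne_zero p), Nat.factorial_succ, Nat.cast_mul]
  field_simp

theorem tsum_gaussTerm_add_one {a c f : ℂ} (ha : NotNonposInt a) (hc : NotNonposInt c)
    (hf : NotNonposInt f) (h : (a + c - f).re < 0) :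
    (f - a - c) * ∑' p, gaussTerm a c f p
      = (f - a) * (f - c) * ∑' p, gaussTerm a c (f + 1) p := by
  have s1 := summable_gaussTerm ha hc hf h
  have s2 : Summable (gaussTerm a c (f + 1)) :=
    summable_gaussTerm ha hc hf.add_one (by simp at h ⊢; linarith)
  have hs := (s2.mul_left ((f - a) * (f - c))).sub (s1.mul_left (f - a - c))
  have hlim := hs.hasSum.tendsto_sum_nat
  have hU : Tendsto (fun p : ℕ => (p : ℂ) * gaussTerm a c f p) atTop (𝓝 0) := by
    obtain ⟨C, hC, hC'⟩ := exists_gaussTerm_bound ha hc hf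
    have ht : Tendsto (fun p : ℕ => C * ((p : ℝ) + 1) ^ ((a + c - f).re)) atTop (𝓝 0) := by
      have := (tendsto_rpow_neg_atTop (y := -(a + c - f).re) (by linarith)).comp
        (tendsto_atTop_add_const_right _ (1 : ℝ) tendsto_natCast_atTop_atTop)
      simpa using this.const_mul C
    refine squeeze_zero_norm (fun p => ?_) ht
    rw [norm_mul, norm_natCast]
    calc (p : ℝ) * ‖gaussTerm a c f p‖
        ≤ ((p : ℝ) + 1) * (C * ((p : ℝ) + 1) ^ ((a + c - f).re - 1)) := by
          gcongr
          · linarith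
          · exact hC' p
      _ = _ := by
        rw [Real.rpow_sub_one (by positivity)]
        field_simp
  have key : ∀ N : ℕ, ∑ p ∈ Finset.range N, ((f - a) * (f - c) * gaussTerm a c (f + 1) p
      - (f - a - c) * gaussTerm a c f p) = N * gaussTerm a c f N := by
    intro N
    rw [← sub_zero ((N : ℂ) * _), ← zero_mul (gaussTerm a c f 0), ← Nat.cast_zero,
      ← Finset.sum_range_sub (fun p : ℕ => (p : ℂ) * gaussTerm a c f p)]
    refine Finset.sum_congr rfl fun p _ => ?_
    rw [succ_mul_gaussTerm_succ ha hc, gaussTerm_eq_mul_add_one hf]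
    ring
  have h0 := tendsto_nhds_unique hlim (hU.congr fun N => (key N).symm)
  rw [(s2.mul_left _).tsum_sub (s1.mul_left _), tsum_mul_left, tsum_mul_left] at h0
  exact (sub_eq_zero.1 h0).symm

theorem norm_Gamma_mul_le {f : ℂ} (hf : 0 < f.re) (n p : ℕ) :
    ‖Gamma (n + f)‖ * ‖Gamma (p + f)‖ ≤ ‖Gamma f‖ * ‖Gamma (p + (f + n))‖ := by
  have hf' : NotNonposInt f := .of_re_pos hf
  induction p with
  | zero => rw [Nat.cast_zero, zero_add, zero_add, add_comm f, mul_comm]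
  | succ p ih =>
    have h : ∀ z : ℂ, ((p + 1 : ℕ) : ℂ) + z = p + z + 1 := fun z => by push_cast; ring
    rw [h, h, Gamma_add_one _ (hf'.nat_add_ne_zero p),
      Gamma_add_one _ ((hf'.add_nat n).nat_add_ne_zero p), norm_mul, norm_mul]
    have hle : ‖(p : ℂ) + f‖ ≤ ‖(p : ℂ) + (f + n)‖ := by
      rw [← abs_of_nonneg (norm_nonneg ((p : ℂ) + f)),
        ← abs_of_nonneg (norm_nonneg ((p : ℂ) + (f + n))), ← sq_le_sq, ← normSq_eq_norm_sq,
        ← normSq_eq_norm_sq, normSq_apply, normSq_apply]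
      simp
      have : (0 : ℝ) ≤ n := n.cast_nonneg
      have : (0 : ℝ) ≤ p := p.cast_nonneg
      nlinarith
    calc _ = ‖(p : ℂ) + f‖ * (‖Gamma (n + f)‖ * ‖Gamma (p + f)‖) := by ring
      _ ≤ ‖(p : ℂ) + (f + n)‖ * (‖Gamma f‖ * ‖Gamma (p + (f + n))‖) := by gcongr
      _ = _ := by ring

theorem tendsto_Gamma_mul_tsum_gaussTerm {a c f : ℂ} (ha : NotNonposInt a) (hc : NotNonposInt c)
    (hf : 0 < f.re) (h : (a + c - f).re < 0) :
    Tendsto (fun n : ℕ => Gamma (n + f) * ∑' p, gaussTerm a c (f + n) p) atTop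
      (𝓝 (Gamma a * Gamma c)) := by
  have hf' : NotNonposInt f := .of_re_pos hf
  have hlim : Gamma a * Gamma c = ∑' p : ℕ, if p = 0 then Gamma a * Gamma c else 0 := by
    rw [tsum_ite_eq]
  rw [hlim]
  simp_rw [← tsum_mul_left]
  refine tendsto_tsum_of_dominated_convergence
    ((summable_gaussTerm ha hc hf' h).norm.mul_left ‖Gamma f‖) (fun p => ?_)
    (.of_forall fun n p => ?_)
  · rcases Nat.eq_zero_or_pos p with rfl | hp
    · refine tendsto_const_nhds.congr fun n => ?_
      have := hf'.Gamma_nat_add_ne_zero n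
      simp only [gaussTerm, if_true, Nat.factorial_zero, Nat.cast_zero, Nat.cast_one, zero_add,
        one_mul, add_comm f]
      field_simp
    · rw [if_neg hp.ne']
      obtain ⟨C, hC, hC'⟩ := exists_Gamma_ratio_bound hf' (hf'.add_nat p)
      have ht : Tendsto (fun n : ℕ => ‖Gamma (p + a) * Gamma (p + c) / p.factorial‖ *
          (C * ((n : ℝ) + 1) ^ (f.re - (f + p).re))) atTop (𝓝 0) := by
        have := (tendsto_rpow_neg_atTop (y := (p : ℝ)) (by exact_mod_cast hp)).comp
          (tendsto_atTop_add_const_right _ (1 : ℝ) tendsto_natCast_atTop_atTop)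
        simpa using (this.const_mul C).const_mul ‖Gamma (p + a) * Gamma (p + c) / p.factorial‖
      refine squeeze_zero_norm (fun n => ?_) ht
      have e : Gamma (n + f) * gaussTerm a c (f + n) p
          = Gamma (p + a) * Gamma (p + c) / p.factorial
            * (Gamma (n + f) / Gamma (n + (f + p))) := by
        rw [gaussTerm, show (n : ℂ) + (f + p) = p + (f + n) by ring]
        ring
      rw [e, norm_mul]
      exact mul_le_mul_of_nonneg_left (hC' n) (norm_nonneg _)
  · have h1 : 0 < ‖Gamma (p + f)‖ := norm_pos_iff.2 (hf'.Gamma_nat_add_ne_zero p)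
    have h2 : 0 < ‖Gamma (p + (f + n))‖ :=
      norm_pos_iff.2 ((hf'.add_nat n).Gamma_nat_add_ne_zero p)
    have hle : ‖Gamma (n + f)‖ / ‖Gamma (p + (f + n))‖ ≤ ‖Gamma f‖ / ‖Gamma (p + f)‖ := by
      rw [div_le_div_iff₀ h2 h1]
      exact norm_Gamma_mul_le hf n p
    simp only [gaussTerm, norm_mul, norm_div]
    calc _ = ‖Gamma (p + a)‖ * ‖Gamma (p + c)‖ / ‖(p.factorial : ℂ)‖
          * (‖Gamma (n + f)‖ / ‖Gamma (p + (f + n))‖) := by ring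
      _ ≤ ‖Gamma (p + a)‖ * ‖Gamma (p + c)‖ / ‖(p.factorial : ℂ)‖
          * (‖Gamma f‖ / ‖Gamma (p + f)‖) := by gcongr
      _ = _ := by ring

theorem tsum_gaussTerm_of_re_pos {a c f : ℂ} (ha : NotNonposInt a) (hc : NotNonposInt c)
    (hf : 0 < f.re) (h : (a + c - f).re < 0) (hfa : NotNonposInt (f - a))
    (hfc : NotNonposInt (f - c)) :
    ∑' p, gaussTerm a c f p
      = Gamma a * Gamma c * Gamma (f - a - c) / (Gamma (f - a) * Gamma (f - c)) := by
  have hf' : NotNonposInt f := .of_re_pos hf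
  have hfac : NotNonposInt (f - a - c) := .of_re_pos (by simp at h ⊢; linarith)
  have hconst : ∀ n : ℕ, Gamma (n + (f - a)) * Gamma (n + (f - c)) / Gamma (n + (f - a - c))
      * ∑' p, gaussTerm a c (f + n) p
      = Gamma (f - a) * Gamma (f - c) / Gamma (f - a - c) * ∑' p, gaussTerm a c f p := by
    intro n
    induction n with
    | zero => simp
    | succ n ih =>
      rw [← ih]
      have hs : ∀ z : ℂ, ((n + 1 : ℕ) : ℂ) + z = n + z + 1 := fun z => by push_cast; ring
      have hrec := tsum_gaussTerm_add_one ha hc (hf'.add_nat n) (by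
        have : (0 : ℝ) ≤ n := n.cast_nonneg
        simp at h ⊢; linarith)
      have e1 := hfac.nat_add_ne_zero n
      have e2 := hfac.Gamma_nat_add_ne_zero n
      rw [hs, hs, hs, Gamma_add_one _ (hfa.nat_add_ne_zero n),
        Gamma_add_one _ (hfc.nat_add_ne_zero n), Gamma_add_one _ e1,
        show f + ((n + 1 : ℕ) : ℂ) = f + n + 1 by push_cast; ring]
      rw [div_mul_eq_mul_div, div_mul_eq_mul_div, div_eq_div_iff (mul_ne_zero e1 e2) e2]
      linear_combination (-Gamma (n + (f - a)) * Gamma (n + (f - c))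
        * Gamma (n + (f - a - c))) * hrec
  have hlim := (tendsto_Gamma_ratio hfa hfc hfac hf' (by ring)).mul
    (tendsto_Gamma_mul_tsum_gaussTerm ha hc hf h)
  have heq := tendsto_nhds_unique tendsto_const_nhds (hlim.congr fun n => by
    refine Eq.trans ?_ (hconst n)
    have := hf'.Gamma_nat_add_ne_zero n
    field_simp)
  have e1 := Gamma_ne_zero hfa
  have e2 := Gamma_ne_zero hfc
  have e3 := Gamma_ne_zero hfac
  rw [one_mul] at heq
  rw [eq_div_iff (mul_ne_zero e1 e2), ← heq]
  field_simp

/-- Gauss's summation theorem. -/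
theorem tsum_gaussTerm {a c f : ℂ} (ha : NotNonposInt a) (hc : NotNonposInt c)
    (hf : NotNonposInt f) (h : (a + c - f).re < 0) :
    ∑' p, gaussTerm a c f p
      = Gamma a * Gamma c * Gamma (f - a - c) / (Gamma (f - a) * Gamma (f - c)) := by
  have hdesc : ∀ n : ℕ, ∀ f : ℂ, NotNonposInt f → (a + c - f).re < 0 →
      0 < (f + n).re → 0 < (f + n - a).re → 0 < (f + n - c).re →
      ∑' p, gaussTerm a c f p
        = Gamma a * Gamma c * Gamma (f - a - c) / (Gamma (f - a) * Gamma (f - c)) := by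
    intro n
    induction n with
    | zero =>
      intro f hf h h1 h2 h3
      simp only [Nat.cast_zero, add_zero] at h1 h2 h3
      exact tsum_gaussTerm_of_re_pos ha hc h1 h (.of_re_pos h2) (.of_re_pos h3)
    | succ n ih =>
      intro f hf h h1 h2 h3
      have e : f + ((n + 1 : ℕ) : ℂ) = f + 1 + n := by push_cast; ring
      rw [e] at h1 h2 h3
      have hfac : NotNonposInt (f - a - c) := .of_re_pos (by simp at h ⊢; linarith)
      have hrec := tsum_gaussTerm_add_one ha hc hf h
      rw [ih _ hf.add_one (by simp at h ⊢; linarith) h1 h2 h3] at hrec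
      refine mul_left_cancel₀ hfac.ne_zero (hrec.trans ?_)
      rw [show f + 1 - a - c = f - a - c + 1 by ring, show f + 1 - a = f - a + 1 by ring,
        show f + 1 - c = f - c + 1 by ring, Gamma_add_one _ hfac.ne_zero]
      simp only [div_eq_mul_inv, mul_inv]
      rw [one_div_Gamma_eq_self_mul_one_div_Gamma_add_one (f - a),
        one_div_Gamma_eq_self_mul_one_div_Gamma_add_one (f - c)]
      ring
  obtain ⟨n, hn⟩ := exists_nat_gt (|f.re| + |a.re| + |c.re|)
  have := neg_abs_le f.re
  have := le_abs_self a.re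
  have := le_abs_self c.re
  have := abs_nonneg a.re
  have := abs_nonneg c.re
  exact hdesc n f hf h (by simp; linarith) (by simp; linarith) (by simp; linarith)

/-- Gauss's series with an additional pole factor `1 / (p + b)`, a `₃F₂` series at `1`. -/
noncomputable def poleSeries (a b c f : ℂ) : ℂ :=
  ∑' p : ℕ, gaussTerm a c f p * (1 / (p + b))

theorem summable_gaussTerm_mul_inv {a b c f : ℂ} (ha : NotNonposInt a) (hb : NotNonposInt b)
    (hc : NotNonposInt c) (hf : NotNonposInt f) (h : (a + c - f).re < 1) :
    Summable (fun p : ℕ => gaussTerm a c f p * (1 / (p + b))) := by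
  obtain ⟨C, hC, hC'⟩ := exists_gaussTerm_bound ha hc hf
  obtain ⟨B, hB, hB'⟩ := exists_inv_nat_add_bound hb
  refine .of_norm_bounded ((summable_nat_add_one_rpow (x := (a + c - f).re - 1 + -1).2
    (by linarith)).mul_left (C * B)) fun p => ?_
  rw [norm_mul, Real.rpow_add (by positivity), ← mul_mul_mul_comm]
  exact mul_le_mul (hC' p) (hB' p) (norm_nonneg _) (by positivity)

theorem re_lt_one_of_summable {a b c f : ℂ} (ha : NotNonposInt a) (hb : NotNonposInt b)
    (hc : NotNonposInt c) (hf : NotNonposInt f)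
    (h : Summable (fun p : ℕ => gaussTerm a c f p * (1 / (p + b)))) : (a + c - f).re < 1 := by
  obtain ⟨A, hA, hA'⟩ := exists_Gamma_ratio_bound notNonposInt_one ha
  obtain ⟨B, hB, hB'⟩ := exists_Gamma_ratio_bound hf hc
  obtain ⟨C, hC, hC'⟩ := exists_Gamma_ratio_bound hb.add_one hb
  have hs : Summable fun p : ℕ => ((p : ℝ) + 1) ^ ((a + c - f).re - 2) := by
    refine .of_nonneg_of_le (fun p => by positivity) (fun p => ?_) (h.norm.mul_left (A * B * C))
    have e1 := ha.Gamma_nat_add_ne_zero p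
    have e2 := hc.Gamma_nat_add_ne_zero p
    have e3 := hf.Gamma_nat_add_ne_zero p
    have e4 := hb.Gamma_nat_add_ne_zero p
    have e5 := hb.nat_add_ne_zero p
    have e6 := notNonposInt_one.Gamma_nat_add_ne_zero p
    have hinv : (gaussTerm a c f p * (1 / (p + b)))⁻¹ = Gamma (p + 1) / Gamma (p + a)
        * (Gamma (p + f) / Gamma (p + c)) * (Gamma (p + (b + 1)) / Gamma (p + b)) := by
      rw [gaussTerm_eq_ratio, ← add_assoc, Gamma_add_one _ e5]
      field_simp
    have hne : gaussTerm a c f p * (1 / (p + b)) ≠ 0 := by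
      rw [gaussTerm_eq_ratio, one_div]
      exact mul_ne_zero (mul_ne_zero (div_ne_zero e1 e6) (div_ne_zero e2 e3)) (inv_ne_zero e5)
    have hle : ‖gaussTerm a c f p * (1 / (p + b))‖⁻¹
        ≤ A * B * C * ((p : ℝ) + 1) ^ (2 - (a + c - f).re) := by
      rw [← norm_inv, hinv, norm_mul, norm_mul]
      refine (mul_le_mul (mul_le_mul (hA' p) (hB' p) (norm_nonneg _) (by positivity)) (hC' p)
        (norm_nonneg _) (by positivity)).trans_eq ?_
      rw [mul_mul_mul_comm A, mul_mul_mul_comm (A * B), ← Real.rpow_add (by positivity),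
        ← Real.rpow_add (by positivity)]
      congr 2
      simp
      ring
    rw [inv_le_iff_one_le_mul₀ (norm_pos_iff.2 hne)] at hle
    have hp : 0 < ((p : ℝ) + 1) ^ (2 - (a + c - f).re) := by positivity
    rw [show (a + c - f).re - 2 = -(2 - (a + c - f).re) by ring, Real.rpow_neg (by positivity),
      inv_le_iff_one_le_mul₀ hp]
    linarith
  have := summable_nat_add_one_rpow.1 hs
  linarith

theorem gaussTerm_add_one_left {a c f : ℂ} (ha : NotNonposInt a) (p : ℕ) :
    gaussTerm (a + 1) c f p = (p + a) * gaussTerm a c f p := by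
  rw [gaussTerm, gaussTerm, ← add_assoc, Gamma_add_one _ (ha.nat_add_ne_zero p)]
  ring

theorem gaussTerm_add_one_middle {a c f : ℂ} (hc : NotNonposInt c) (p : ℕ) :
    gaussTerm a (c + 1) f p = (p + c) * gaussTerm a c f p := by
  rw [gaussTerm, gaussTerm, ← add_assoc, Gamma_add_one _ (hc.nat_add_ne_zero p)]
  ring

theorem poleSeries_add_one_left {a b c f : ℂ} (ha : NotNonposInt a) (hb : NotNonposInt b)
    (hc : NotNonposInt c) (hf : NotNonposInt f) (h : (a + c - f).re < 0) :
    poleSeries (a + 1) b c f = ∑' p, gaussTerm a c f p + (a - b) * poleSeries a b c f := by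
  have s1 := summable_gaussTerm ha hc hf h
  have s2 := summable_gaussTerm_mul_inv ha hb hc hf (by linarith)
  rw [poleSeries, poleSeries, ← tsum_mul_left, ← s1.tsum_add (s2.mul_left _)]
  refine tsum_congr fun p => ?_
  have := hb.nat_add_ne_zero p
  rw [gaussTerm_add_one_left ha]
  field_simp
  ring

theorem poleSeries_eq_add_one_right {a b c f : ℂ} (ha : NotNonposInt a) (hb : NotNonposInt b)
    (hc : NotNonposInt c) (hf : NotNonposInt f) (h : (a + c - f).re < 1) :
    poleSeries a b c f
      = ∑' p, gaussTerm a c (f + 1) p + (f - b) * poleSeries a b c (f + 1) := by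
  have h' : (a + c - (f + 1)).re < 0 := by simp at h ⊢; linarith
  have s1 := summable_gaussTerm ha hc hf.add_one h'
  have s2 := summable_gaussTerm_mul_inv ha hb hc hf.add_one (by linarith)
  rw [poleSeries, poleSeries, ← tsum_mul_left, ← s1.tsum_add (s2.mul_left _)]
  refine tsum_congr fun p => ?_
  have := hb.nat_add_ne_zero p
  rw [gaussTerm_eq_mul_add_one hf]
  field_simp
  ring

theorem poleSeries_add_one_add_one {a b c f : ℂ} (ha : NotNonposInt a) (hb : NotNonposInt b)
    (hc : NotNonposInt c) (hf : NotNonposInt f) (h : (a + c - f).re < 1) :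
    (f - b) * poleSeries a b (c + 1) (f + 1)
      = (c - b) * poleSeries a b c f + (f - c) * ∑' p, gaussTerm a c (f + 1) p := by
  have h' : (a + c - (f + 1)).re < 0 := by simp at h ⊢; linarith
  have s1 := summable_gaussTerm ha hc hf.add_one h'
  have s2 := summable_gaussTerm_mul_inv ha hb hc hf h
  rw [poleSeries, poleSeries, ← tsum_mul_left, ← tsum_mul_left, ← tsum_mul_left,
    ← (s2.mul_left _).tsum_add (s1.mul_left _)]
  refine tsum_congr fun p => ?_
  have := hb.nat_add_ne_zero p
  rw [gaussTerm_eq_mul_add_one hf, gaussTerm_add_one_middle hc]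
  field_simp
  ring

theorem poleSeries_add_one_all {a b c f : ℂ} (ha : NotNonposInt a) (hb : NotNonposInt b)
    (hc : NotNonposInt c) (hf : NotNonposInt f) (h : (a + c - f).re < 0) :
    (b - a) * poleSeries (a + 1) (b + 1) (c + 1) (f + 1)
      = b * poleSeries (a + 1) b c f - a * ∑' p, gaussTerm a c f p := by
  have s1 := summable_gaussTerm ha hc hf h
  have s2 := summable_gaussTerm_mul_inv ha.add_one hb hc hf (by simp at h ⊢; linarith)
  have hterm : ∀ q : ℕ, b * (gaussTerm (a + 1) c f q * (1 / (q + b))) - a * gaussTerm a c f q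
      = (b - a) * (q * gaussTerm a c f q * (1 / (q + b))) := fun q => by
    have := hb.nat_add_ne_zero q
    rw [gaussTerm_add_one_left ha]
    field_simp
    ring
  have s3 := (s2.mul_left b).sub (s1.mul_left a)
  rw [poleSeries, poleSeries, ← tsum_mul_left, ← tsum_mul_left, ← tsum_mul_left,
    ← (s2.mul_left _).tsum_sub (s1.mul_left _), s3.tsum_eq_zero_add, hterm]
  simp only [Nat.cast_zero, zero_mul, mul_zero, zero_add]
  refine tsum_congr fun p => ?_
  have hz : ∀ z : ℂ, (p : ℂ) + (z + 1) = ((p + 1 : ℕ) : ℂ) + z := fun z => by push_cast; ring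
  have hp : ((p + 1 : ℕ) : ℂ) ≠ 0 := by exact_mod_cast p.succ_ne_zero
  rw [hterm, hz b, gaussTerm, gaussTerm, hz a, hz c, hz f, Nat.factorial_succ, Nat.cast_mul]
  field_simp

/-- The parameters for which both sides of the transformation are defined and converge. -/
structure Admissible (a b c f : ℂ) : Prop where
  ha : NotNonposInt a
  one_sub_a : NotNonposInt (1 - a)
  hb : NotNonposInt b
  hc : NotNonposInt c
  hf : NotNonposInt f
  c_sub_b : NotNonposInt (c - b)
  f_sub_b : NotNonposInt (f - b)
  b_sub_a : NotNonposInt (1 + b - a)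
  f_sub_c : NotNonposInt (f - c)
  c_sub_f : NotNonposInt (1 + c - f)
  c_sub_a : NotNonposInt (1 + c - a)
  re_lt_one : (a + c - f).re < 1

/-- The left side minus the right side of the transformation. -/
noncomputable def transformationDefect (a b c f : ℂ) : ℂ :=
  poleSeries a b c f
    - (Gamma a * Gamma (1 - a) * Gamma b * Gamma (c - b) / (Gamma (f - b) * Gamma (1 + b - a))
      - Gamma (1 - a) * Gamma a / (Gamma (f - c) * Gamma (1 + c - f))
        * poleSeries (1 + c - f) (c - b) c (1 + c - a))

namespace Admissible

variable {a b c f : ℂ}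

theorem sub_one_not (h : Admissible a b c f) : NotNonposInt (a - 1) := fun n hn => by
  cases n with
  | zero => exact h.one_sub_a.ne_zero (by simp at hn; linear_combination -hn)
  | succ n => exact h.ha n (by push_cast at hn; linear_combination hn)

theorem sub_one (h : Admissible a b c f) : Admissible (a - 1) b c f where
  ha := h.sub_one_not
  one_sub_a := by convert h.one_sub_a.add_one using 1; ring
  hb := h.hb
  hc := h.hc
  hf := h.hf
  c_sub_b := h.c_sub_b
  f_sub_b := h.f_sub_b
  b_sub_a := by convert h.b_sub_a.add_one using 1; ring
  f_sub_c := h.f_sub_c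
  c_sub_f := h.c_sub_f
  c_sub_a := by convert h.c_sub_a.add_one using 1; ring
  re_lt_one := by have := h.re_lt_one; simp at this ⊢; linarith

theorem add_nat (h : Admissible a b c f) (n : ℕ) : Admissible a b (c + n) (f + n) where
  ha := h.ha
  one_sub_a := h.one_sub_a
  hb := h.hb
  hc := h.hc.add_nat n
  hf := h.hf.add_nat n
  c_sub_b := by convert h.c_sub_b.add_nat n using 1; ring
  f_sub_b := by convert h.f_sub_b.add_nat n using 1; ring
  b_sub_a := h.b_sub_a
  f_sub_c := by convert h.f_sub_c using 1; ring
  c_sub_f := by convert h.c_sub_f using 1; ring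
  c_sub_a := by convert h.c_sub_a.add_nat n using 1; ring
  re_lt_one := by have := h.re_lt_one; simp at this ⊢; linarith

theorem transformationDefect_eq_sub_one (h : Admissible a b c f) :
    transformationDefect a b c f = (a - 1 - b) * transformationDefect (a - 1) b c f := by
  have hre := h.re_lt_one
  have hF := poleSeries_add_one_left h.sub_one_not h.hb h.hc h.hf (by simp at hre ⊢; linarith)
  have hH := poleSeries_eq_add_one_right h.c_sub_f h.c_sub_b h.hc h.c_sub_a
    (by simp at hre ⊢; linarith)
  rw [tsum_gaussTerm h.sub_one_not h.hc h.hf (by simp at hre ⊢; linarith), sub_add_cancel] at hF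
  rw [tsum_gaussTerm h.c_sub_f h.hc h.c_sub_a.add_one (by simp at hre ⊢; linarith)] at hH
  rw [transformationDefect, transformationDefect, hF, hH,
    show 1 + c - (a - 1) = 1 + c - a + 1 by ring,
    show 1 + b - (a - 1) = 1 + b - a + 1 by ring, Gamma_add_one _ h.b_sub_a.ne_zero,
    show 1 - (a - 1) = 1 - a + 1 by ring, Gamma_add_one _ h.one_sub_a.ne_zero,
    show 1 + c - a + 1 - (1 + c - f) - c = f - (a - 1) - c by ring,
    show 1 + c - a + 1 - (1 + c - f) = f - (a - 1) by ring,
    show 1 + c - a + 1 - c = 1 - a + 1 by ring, Gamma_add_one _ h.one_sub_a.ne_zero]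
  have ea : Gamma a = (a - 1) * Gamma (a - 1) := by
    rw [← Gamma_add_one _ h.sub_one_not.ne_zero, sub_add_cancel]
  rw [ea]
  have e1 := Gamma_ne_zero h.one_sub_a
  have e2 := Gamma_ne_zero h.b_sub_a
  have e3 := Gamma_ne_zero h.f_sub_c
  have e4 := Gamma_ne_zero h.c_sub_f
  have e5 := Gamma_ne_zero h.f_sub_b
  have e6 := h.one_sub_a.ne_zero
  have e7 := h.b_sub_a.ne_zero
  simp only [div_eq_mul_inv, mul_inv]
  generalize (Gamma (f - (a - 1)))⁻¹ = x
  field_simp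
  ring

theorem transformationDefect_add_one (h : Admissible a b c f) :
    (f - b) * transformationDefect a b (c + 1) (f + 1)
      = (c - b) * transformationDefect a b c f := by
  have hre := h.re_lt_one
  have hcf : NotNonposInt (c - f) := fun n hn => by
    cases n with
    | zero => exact h.f_sub_c.ne_zero (by simp at hn; linear_combination -hn)
    | succ n => exact h.c_sub_f n (by push_cast at hn; linear_combination hn)
  have hF := poleSeries_add_one_add_one h.ha h.hb h.hc h.hf hre
  have hH := poleSeries_add_one_all hcf h.c_sub_b h.hc h.c_sub_a (by simp at hre ⊢; linarith)
  rw [tsum_gaussTerm h.ha h.hc h.hf.add_one (by simp at hre ⊢; linarith),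
    show f + 1 - c = f - c + 1 by ring, Gamma_add_one _ h.f_sub_c.ne_zero] at hF
  rw [tsum_gaussTerm hcf h.hc h.c_sub_a (by simp at hre ⊢; linarith),
    show 1 + c - a - (c - f) - c = f + 1 - a - c by ring,
    show 1 + c - a - (c - f) = f + 1 - a by ring, show 1 + c - a - c = 1 - a by ring] at hH
  rw [transformationDefect, transformationDefect,
    show 1 + (c + 1) - (f + 1) = c - f + 1 by ring, show f + 1 - (c + 1) = f - c by ring,
    show 1 + c - f = c - f + 1 by ring, show 1 + (c + 1) - a = 1 + c - a + 1 by ring,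
    show c + 1 - b = c - b + 1 by ring, show f + 1 - b = f - b + 1 by ring,
    Gamma_add_one _ h.c_sub_b.ne_zero, Gamma_add_one _ h.f_sub_b.ne_zero,
    Gamma_add_one _ hcf.ne_zero]
  have e1 := Gamma_ne_zero h.one_sub_a
  have e2 := Gamma_ne_zero h.b_sub_a
  have e3 := Gamma_ne_zero h.f_sub_c
  have e4 := Gamma_ne_zero hcf
  have e5 := Gamma_ne_zero h.f_sub_b
  have e6 := h.f_sub_b.ne_zero
  have e7 := hcf.ne_zero
  have e8 := h.f_sub_c.ne_zero
  rw [mul_sub, hF, mul_sub, mul_left_comm (f - b) (_ / _),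
    show (f - b) = c - b - (c - f) by ring, hH]
  rw [show c - b - (c - f) = f - b by ring]
  simp only [div_eq_mul_inv, mul_inv]
  generalize (Gamma (f + 1 - a))⁻¹ = x
  field_simp
  ring

end Admissible

theorem rpow_mul_rpow_neg_le (δ : ℝ) (n p : ℕ) :
    ((n : ℝ) + 1) ^ δ * (((p + n : ℕ) : ℝ) + 1) ^ (-δ) ≤ ((p : ℝ) + 1) ^ |δ| := by
  have hn : (0 : ℝ) < (n : ℝ) + 1 := by positivity
  have hp : (0 : ℝ) ≤ p := p.cast_nonneg
  have hn' : (0 : ℝ) ≤ n := n.cast_nonneg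
  have h1 : (1 : ℝ) ≤ (((p + n : ℕ) : ℝ) + 1) / ((n : ℝ) + 1) := by
    rw [le_div_iff₀ hn]; push_cast; linarith
  have h2 : (((p + n : ℕ) : ℝ) + 1) / ((n : ℝ) + 1) ≤ (p : ℝ) + 1 := by
    rw [div_le_iff₀ hn]; push_cast; nlinarith
  calc _ = ((((p + n : ℕ) : ℝ) + 1) / ((n : ℝ) + 1)) ^ (-δ) := by
        rw [Real.div_rpow (by positivity) hn.le, Real.rpow_neg hn.le δ, div_inv_eq_mul, mul_comm]
    _ ≤ ((((p + n : ℕ) : ℝ) + 1) / ((n : ℝ) + 1)) ^ |δ| :=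
        Real.rpow_le_rpow_of_exponent_le h1 (neg_le_abs δ)
    _ ≤ _ := Real.rpow_le_rpow (by positivity) h2 (abs_nonneg δ)

theorem rpow_mul_rpow_mul_rpow_le_s15 {δ x : ℝ} (hx : x ≤ -1 - 2 * |δ|) (n p : ℕ) :
    ((n : ℝ) + 1) ^ δ * (((p : ℝ) + 1) ^ (-δ) * (((p + n : ℕ) : ℝ) + 1) ^ (x - 2))
      ≤ ((p : ℝ) + 1) ^ (-2 : ℝ) * ((n : ℝ) + 1) ^ (-1 : ℝ) := by
  have hp : (0 : ℝ) ≤ p := p.cast_nonneg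
  have hn : (0 : ℝ) ≤ n := n.cast_nonneg
  have h1 : (1 : ℝ) ≤ (p : ℝ) + 1 := by linarith
  have h2 : (1 : ℝ) ≤ (n : ℝ) + 1 := by linarith
  have h3 : (1 : ℝ) ≤ ((p + n : ℕ) : ℝ) + 1 := by push_cast; linarith
  have hδ := abs_nonneg δ
  calc _ ≤ ((n : ℝ) + 1) ^ |δ| * (((p : ℝ) + 1) ^ |δ|
        * (((p + n : ℕ) : ℝ) + 1) ^ (-(|δ| + 2) + -(|δ| + 1))) := by
        gcongr
        · exact le_abs_self δ
        · exact neg_le_abs δ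
        · linarith
    _ ≤ ((n : ℝ) + 1) ^ |δ| * (((p : ℝ) + 1) ^ |δ|
        * (((p : ℝ) + 1) ^ (-(|δ| + 2)) * ((n : ℝ) + 1) ^ (-(|δ| + 1)))) := by
        rw [Real.rpow_add (by positivity)]
        gcongr ?_ * (?_ * (?_ * ?_))
        · exact Real.rpow_le_rpow_of_nonpos (by positivity) (by push_cast; linarith) (by linarith)
        · exact Real.rpow_le_rpow_of_nonpos (by positivity) (by push_cast; linarith) (by linarith)
    _ = (((p : ℝ) + 1) ^ |δ| * ((p : ℝ) + 1) ^ (-(|δ| + 2)))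
        * (((n : ℝ) + 1) ^ |δ| * ((n : ℝ) + 1) ^ (-(|δ| + 1))) := by ring
    _ = _ := by
        rw [← Real.rpow_add (by positivity), ← Real.rpow_add (by positivity)]
        congr 2 <;> ring

namespace Admissible

variable {a b c f : ℂ}

theorem tendsto_mul_poleSeries (h : Admissible a b c f) (hre : a.re ≤ -1 - 2 * |(f - c).re|) :
    Tendsto (fun n : ℕ => Gamma (n + (f - b)) / Gamma (n + (c - b))
      * poleSeries a b (c + n) (f + n)) atTop (𝓝 (∑' p, gaussTerm a b (b + 1) p)) := by
  obtain ⟨A, hA, hA'⟩ := exists_Gamma_ratio_bound h.ha notNonposInt_one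
  obtain ⟨B, hB, hB'⟩ := exists_Gamma_ratio_bound h.hc h.hf
  obtain ⟨C, hC, hC'⟩ := exists_inv_nat_add_bound h.hb
  obtain ⟨E, hE, hE'⟩ := exists_Gamma_ratio_bound h.f_sub_b h.c_sub_b
  have hδ := abs_nonneg (f - c).re
  have hterm : ∀ n p : ℕ, Gamma (n + (f - b)) / Gamma (n + (c - b))
      * (gaussTerm a (c + n) (f + n) p * (1 / (p + b)))
      = Gamma (n + (f - b)) / Gamma (n + (c - b)) * (Gamma (p + a) / Gamma (p + 1)
        * (Gamma ((p + n : ℕ) + c) / Gamma ((p + n : ℕ) + f)) * (1 / (p + b))) := by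
    intro n p
    rw [gaussTerm_eq_ratio, show ∀ z : ℂ, (p : ℂ) + (z + n) = (p + n : ℕ) + z from
      fun z => by push_cast; ring, show (p : ℂ) + (f + n) = (p + n : ℕ) + f by push_cast; ring]
  simp_rw [poleSeries, ← tsum_mul_left, hterm]
  refine tendsto_tsum_of_dominated_convergence
    (bound := fun p : ℕ => E * A * B * C * ((p : ℝ) + 1) ^ (a.re - 1 + -1 + |(f - c).re|))
    ((summable_nat_add_one_rpow.2 (by linarith)).mul_left _) (fun p => ?_)
    (.of_forall fun n p => ?_)
  · have hlim := (tendsto_Gamma_ratio h.f_sub_b (h.hc.add_nat p) h.c_sub_b (h.hf.add_nat p)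
      (by ring)).const_mul (gaussTerm a b (b + 1) p)
    rw [mul_one] at hlim
    refine hlim.congr fun n => ?_
    have e1 := h.hb.nat_add_ne_zero p
    have e2 := h.hb.Gamma_nat_add_ne_zero p
    rw [gaussTerm_eq_ratio, ← add_assoc (p : ℂ) b 1, Gamma_add_one _ e1,
      show ((p + n : ℕ) : ℂ) + c = n + (c + p) by push_cast; ring,
      show ((p + n : ℕ) : ℂ) + f = n + (f + p) by push_cast; ring]
    field_simp
  · rw [norm_mul, norm_mul, norm_mul]
    calc _ ≤ E * ((n : ℝ) + 1) ^ ((f - b).re - (c - b).re) * (A * ((p : ℝ) + 1) ^ (a.re - re 1)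
          * (B * (((p + n : ℕ) : ℝ) + 1) ^ (c.re - f.re)) * (C * ((p : ℝ) + 1) ^ (-1 : ℝ))) := by
          gcongr ?_ * (?_ * ?_ * ?_)
          · exact hE' n
          · exact hA' p
          · exact hB' (p + n)
          · exact hC' p
      _ = E * A * B * C * (((n : ℝ) + 1) ^ (f - c).re * (((p + n : ℕ) : ℝ) + 1) ^ (-(f - c).re))
          * (((p : ℝ) + 1) ^ (a.re - 1) * ((p : ℝ) + 1) ^ (-1 : ℝ)) := by
          rw [show (f - b).re - (c - b).re = (f - c).re by simp,
            show c.re - f.re = -(f - c).re by simp, one_re]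
          ring
      _ ≤ E * A * B * C * ((p : ℝ) + 1) ^ |(f - c).re|
          * (((p : ℝ) + 1) ^ (a.re - 1) * ((p : ℝ) + 1) ^ (-1 : ℝ)) := by
          gcongr
          exact rpow_mul_rpow_neg_le _ n p
      _ = _ := by
          rw [Real.rpow_add (by positivity), Real.rpow_add (by positivity)]
          ring

theorem tendsto_mul_poleSeries_dual (h : Admissible a b c f)
    (hre : a.re ≤ -1 - 2 * |(f - c).re|) :
    Tendsto (fun n : ℕ => Gamma (n + (f - b)) / Gamma (n + (c - b))
      * poleSeries (1 + c - f) (c + n - b) (c + n) (1 + (c + n) - a)) atTop (𝓝 0) := by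
  obtain ⟨A, hA, hA'⟩ := exists_Gamma_ratio_bound h.c_sub_f notNonposInt_one
  obtain ⟨B, hB, hB'⟩ := exists_Gamma_ratio_bound h.hc h.c_sub_a
  obtain ⟨C, hC, hC'⟩ := exists_inv_nat_add_bound h.c_sub_b
  obtain ⟨E, hE, hE'⟩ := exists_Gamma_ratio_bound h.f_sub_b h.c_sub_b
  have hs := (summable_nat_add_one_rpow (x := -2)).2 (by norm_num)
  set S := ∑' p : ℕ, ((p : ℝ) + 1) ^ (-2 : ℝ)
  have ht : Tendsto (fun n : ℕ => E * A * B * C * ((n : ℝ) + 1) ^ (-1 : ℝ) * S) atTop (𝓝 0) := by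
    have := (tendsto_rpow_neg_atTop one_pos).comp
      (tendsto_atTop_add_const_right _ (1 : ℝ) tendsto_natCast_atTop_atTop)
    simpa using (this.const_mul (E * A * B * C)).mul_const S
  refine squeeze_zero_norm (fun n => ?_) ht
  rw [poleSeries, ← tsum_mul_left]
  refine tsum_of_norm_bounded (hs.hasSum.mul_left _) fun p => ?_
  rw [gaussTerm_eq_ratio, show (p : ℂ) + (c + n) = (p + n : ℕ) + c by push_cast; ring,
    show (p : ℂ) + (1 + (c + n) - a) = (p + n : ℕ) + (1 + c - a) by push_cast; ring,
    show (p : ℂ) + (c + n - b) = (p + n : ℕ) + (c - b) by push_cast; ring,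
    norm_mul, norm_mul, norm_mul]
  calc _ ≤ E * ((n : ℝ) + 1) ^ ((f - b).re - (c - b).re)
        * (A * ((p : ℝ) + 1) ^ ((1 + c - f).re - re 1)
        * (B * (((p + n : ℕ) : ℝ) + 1) ^ (c.re - (1 + c - a).re))
        * (C * (((p + n : ℕ) : ℝ) + 1) ^ (-1 : ℝ))) := by
        gcongr ?_ * (?_ * ?_ * ?_)
        · exact hE' n
        · exact hA' p
        · exact hB' (p + n)
        · exact hC' (p + n)
    _ = E * A * B * C * (((n : ℝ) + 1) ^ (f - c).re * (((p : ℝ) + 1) ^ (-(f - c).re)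
        * (((p + n : ℕ) : ℝ) + 1) ^ (a.re - 2))) := by
        rw [show (f - b).re - (c - b).re = (f - c).re by simp,
          show (1 + c - f).re - re 1 = -(f - c).re by simp; ring,
          show a.re - 2 = c.re - (1 + c - a).re + -1 by simp; ring,
          Real.rpow_add (by positivity)]
        ring
    _ ≤ E * A * B * C * (((p : ℝ) + 1) ^ (-2 : ℝ) * ((n : ℝ) + 1) ^ (-1 : ℝ)) := by
        exact mul_le_mul_of_nonneg_left (rpow_mul_rpow_mul_rpow_le_s15 hre n p) (by positivity)
    _ = _ := by ring

theorem mul_transformationDefect_add_nat (h : Admissible a b c f) (n : ℕ) :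
    Gamma (n + (f - b)) / Gamma (n + (c - b)) * transformationDefect a b (c + n) (f + n)
      = Gamma (f - b) / Gamma (c - b) * transformationDefect a b c f := by
  induction n with
  | zero => simp
  | succ n ih =>
    rw [← ih]
    have hs : ∀ z : ℂ, ((n + 1 : ℕ) : ℂ) + z = n + z + 1 := fun z => by push_cast; ring
    have hrec := (h.add_nat n).transformationDefect_add_one
    have e1 := h.c_sub_b.nat_add_ne_zero n
    have e2 := h.c_sub_b.Gamma_nat_add_ne_zero n
    rw [hs, hs, Gamma_add_one _ e1, Gamma_add_one _ (h.f_sub_b.nat_add_ne_zero n),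
      show c + ((n + 1 : ℕ) : ℂ) = c + n + 1 by push_cast; ring,
      show f + ((n + 1 : ℕ) : ℂ) = f + n + 1 by push_cast; ring,
      div_mul_eq_mul_div, div_mul_eq_mul_div, div_eq_div_iff (mul_ne_zero e1 e2) e2]
    linear_combination Gamma (n + (f - b)) * Gamma (n + (c - b)) * hrec

theorem transformationDefect_eq_zero_of_re_le (h : Admissible a b c f)
    (hre : a.re ≤ -1 - 2 * |(f - c).re|) : transformationDefect a b c f = 0 := by
  have hδ := abs_nonneg (f - c).re
  have hlim := ((h.tendsto_mul_poleSeries hre).sub_const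
    (Gamma a * Gamma (1 - a) * Gamma b / Gamma (1 + b - a))).add
    ((h.tendsto_mul_poleSeries_dual hre).const_mul
      (Gamma (1 - a) * Gamma a / (Gamma (f - c) * Gamma (1 + c - f))))
  rw [tsum_gaussTerm h.ha h.hb h.hb.add_one (by simp; linarith),
    show b + 1 - a - b = 1 - a by ring, add_sub_cancel_left, Gamma_one, mul_one, mul_zero,
    add_zero, show b + 1 - a = 1 + b - a by ring,
    mul_right_comm (Gamma a) (Gamma b), sub_self] at hlim
  have heq := tendsto_nhds_unique tendsto_const_nhds (hlim.congr fun n => by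
    refine Eq.trans ?_ (h.mul_transformationDefect_add_nat n)
    have e1 := h.c_sub_b.Gamma_nat_add_ne_zero n
    have e2 := h.f_sub_b.Gamma_nat_add_ne_zero n
    have e3 := Gamma_ne_zero h.b_sub_a
    rw [transformationDefect, show f + n - (c + n) = f - c by ring,
      show 1 + (c + n) - (f + n) = 1 + c - f by ring]
    have e4 : Gamma (n + (f - b)) / Gamma (n + (c - b))
        * (Gamma a * Gamma (1 - a) * Gamma b * Gamma (c + n - b)
          / (Gamma (f + n - b) * Gamma (1 + b - a)))
        = Gamma a * Gamma (1 - a) * Gamma b / Gamma (1 + b - a) := by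
      rw [show c + n - b = n + (c - b) by ring, show f + n - b = n + (f - b) by ring]
      field_simp
    rw [← e4]
    ring)
  exact (mul_eq_zero.1 heq).resolve_left
    (div_ne_zero (Gamma_ne_zero h.f_sub_b) (Gamma_ne_zero h.c_sub_b))

theorem transformationDefect_eq_zero (h : Admissible a b c f) :
    transformationDefect a b c f = 0 := by
  obtain ⟨n, hn⟩ := exists_nat_ge (a.re + 1 + 2 * |(f - c).re|)
  induction n generalizing a with
  | zero => exact h.transformationDefect_eq_zero_of_re_le (by simp at hn ⊢; linarith)
  | succ n ih =>
    rw [h.transformationDefect_eq_sub_one,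
      ih h.sub_one (by push_cast at hn; simp at hn ⊢; linarith), mul_zero]

end Admissible

/-- A ₃F₂-type transformation:
    Σ_{p≥0} Γ(p+a)Γ(p+c)/(p!Γ(p+f)) · 1/(p+b)
      = Γ(a)Γ(1−a)Γ(b)Γ(c−b)/(Γ(f−b)Γ(1+b−a))
        − [Γ(1−a)Γ(a)/(Γ(f−c)Γ(1+c−f))]·Σ_{p≥0} Γ(p+c−f+1)Γ(p+c)/(p!Γ(p+1+c−a)) · 1/(p+c−b). -/
theorem hypergeom_sum_transformation (a b c f : ℂ)
    (hsum1 : Summable (fun p : ℕ =>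
      Complex.Gamma (p + a) * Complex.Gamma (p + c)
        / ((p.factorial : ℂ) * Complex.Gamma (p + f)) * (1 / (p + b))))
    (hsum2 : Summable (fun p : ℕ =>
      Complex.Gamma (p + c - f + 1) * Complex.Gamma (p + c)
        / ((p.factorial : ℂ) * Complex.Gamma (p + 1 + c - a)) * (1 / (p + c - b))))
    (h1 : NotNonposInt a) (h2 : NotNonposInt (1 - a)) (h3 : NotNonposInt b)
    (h4 : NotNonposInt c) (h5 : NotNonposInt f) (h6 : NotNonposInt (c - b))
    (h7 : NotNonposInt (f - b)) (h8 : NotNonposInt (1 + b - a))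
    (h9 : NotNonposInt (f - c)) (h10 : NotNonposInt (1 + c - f))
    (h11 : NotNonposInt (c - f + 1)) (h12 : NotNonposInt (1 + c - a)) :
    (∑' p : ℕ, Complex.Gamma (p + a) * Complex.Gamma (p + c)
        / ((p.factorial : ℂ) * Complex.Gamma (p + f)) * (1 / (p + b)))
      = Complex.Gamma a * Complex.Gamma (1 - a) * Complex.Gamma b * Complex.Gamma (c - b)
          / (Complex.Gamma (f - b) * Complex.Gamma (1 + b - a))
        - Complex.Gamma (1 - a) * Complex.Gamma a
            / (Complex.Gamma (f - c) * Complex.Gamma (1 + c - f))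
          * ∑' p : ℕ, Complex.Gamma (p + c - f + 1) * Complex.Gamma (p + c)
              / ((p.factorial : ℂ) * Complex.Gamma (p + 1 + c - a)) * (1 / (p + c - b)) := by
  have hF : ∀ p : ℕ, Complex.Gamma (p + a) * Complex.Gamma (p + c)
      / ((p.factorial : ℂ) * Complex.Gamma (p + f)) * (1 / (p + b))
      = gaussTerm a c f p * (1 / (p + b)) := fun p => rfl
  have hH : ∀ p : ℕ, Complex.Gamma (p + c - f + 1) * Complex.Gamma (p + c)
      / ((p.factorial : ℂ) * Complex.Gamma (p + 1 + c - a)) * (1 / (p + c - b))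
      = gaussTerm (1 + c - f) c (1 + c - a) p * (1 / (p + (c - b))) := fun p => by
    rw [gaussTerm, show (p : ℂ) + c - f + 1 = p + (1 + c - f) by ring,
      show (p : ℂ) + 1 + c - a = p + (1 + c - a) by ring, add_sub_assoc (p : ℂ) c b]
  simp_rw [hF] at hsum1 ⊢
  simp_rw [hH]
  have h : Admissible a b c f :=
    ⟨h1, h2, h3, h4, h5, h6, h7, h8, h9, h10, h12, re_lt_one_of_summable h1 h3 h4 h5 hsum1⟩
  exact sub_eq_zero.1 h.transformationDefect_eq_zero
end
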